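/- arXiv:math/0106229 — 2 statements merged into one kernel-verified Lean document; each statement's English description precedes it below -/
import Mathlib

section
/- (Generating function identity) Let P be a simple lattice multi-polytope over a complete simplicial multi-fan Δ with primitive ray vectors v_i in the lattice N. For each I∈Σ^{(n)}, let N_I ⊂ N be the sublattice generated by {v_i : i∈I}, {u_i^I} the dual basis of {v_i : i∈I} in N_I*, u_I the corresponding vertex, and χ_I(u, g) = exp(2π√−1 ⟨u, v_g⟩) for u∈N_I* and g∈N/N_I with representative v_g. Then for any v∈N such that all ⟨u_i^I, v⟩ are nonzero integers, Σ_{I∈Σ^{(n)}} (w(I) z^{⟨u_I,v⟩}/|N/N_I|) Σ_{g∈N/N_I} 1/∏_{i∈I}(1 − χ_I(u_i^I, g) z^{−⟨u_i^I,v⟩}) = Σ_{u∈N*} DH_{P_+}(u) z^{⟨u,v⟩} as rational functions of z ∈ ℂ. -/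
open Finset

/-- The pairing between a covector and a vector in `ℝⁿ`. -/
def dotp {n : ℕ} (x y : Fin n → ℝ) : ℝ := ∑ k, x k * y k

/-- A (simplicial) multi-fan of dimension `n` with rays indexed by `{1,…,d}`:
an augmented simplicial set `S`, ray vectors `v i` spanning the simplicial cones
`C(I) = pos span {v i : i ∈ I}`, and a weight `w` on simplices (the difference
`w = w⁺ − w⁻` of the two weight functions, restricted to top simplices is what matters). -/
structure MultiFan (n d : ℕ) where
  S : Finset (Finset (Fin d))
  empty_mem : ∅ ∈ S
  downClosed : ∀ I ∈ S, ∀ J ⊆ I, J ∈ S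
  card_le : ∀ I ∈ S, I.card ≤ n
  v : Fin d → (Fin n → ℝ)
  indep : ∀ I ∈ S, LinearIndependent ℝ (fun i : {x // x ∈ I} => v i.1)
  w : Finset (Fin d) → ℤ

namespace MultiFan

variable {n d : ℕ}

/-- `x` is generic for the projected multi-fan `Δ_K`: it avoids every linear subspace
spanned by a cone (containing `C(K)`) of dimension `< n`. -/
def GenericFor (Δ : MultiFan n d) (K : Finset (Fin d)) (x : Fin n → ℝ) : Prop :=
  ∀ L ∈ Δ.S, K ⊆ L → L.card < n → x ∉ Submodule.span ℝ (Δ.v '' (L : Set (Fin d)))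

def Generic (Δ : MultiFan n d) (x : Fin n → ℝ) : Prop := Δ.GenericFor ∅ x

/-- `x` lies (mod the span of `C(K)`) in the projected cone `C_K(I)`. -/
def InProjCone (Δ : MultiFan n d) (K I : Finset (Fin d)) (x : Fin n → ℝ) : Prop :=
  ∃ a : Fin d → ℝ, (∀ j ∈ I \ K, 0 ≤ a j) ∧
    (x - ∑ j ∈ I \ K, a j • Δ.v j) ∈ Submodule.span ℝ (Δ.v '' (K : Set (Fin d)))

open scoped Classical in
/-- `d_x` for the projected multi-fan `Δ_K`: the sum of the weights of top cones whose
projection contains the projection of `x`. -/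
noncomputable def dv (Δ : MultiFan n d) (K : Finset (Fin d)) (x : Fin n → ℝ) : ℤ :=
  ∑ I ∈ Δ.S.filter (fun I => I.card = n ∧ K ⊆ I ∧ Δ.InProjCone K I x), Δ.w I

/-- Pre-completeness of the projected multi-fan `Δ_K`. -/
def PreCompleteAt (Δ : MultiFan n d) (K : Finset (Fin d)) : Prop :=
  (∃ I ∈ Δ.S, K ⊆ I ∧ I.card = n) ∧
  ∀ x y : Fin n → ℝ, Δ.GenericFor K x → Δ.GenericFor K y → Δ.dv K x = Δ.dv K y

/-- Completeness: every projected multi-fan is pre-complete. -/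
def Complete (Δ : MultiFan n d) : Prop := ∀ K ∈ Δ.S, Δ.PreCompleteAt K

open scoped Classical in
/-- The Duistermaat–Heckman function of the simple multi-polytope `(Δ, {F_i})`, where
`F_i = {u : ⟨u, v i⟩ = c i}`, the data `uu I i = u_i^I` is the dual basis of `{v i : i ∈ I}`
and `ξ ∈ V` is a generic vector.  For `I ∈ Σ^{(n)}` the coefficient of `u − u_I` on `u_i^I`
is `⟨u, v i⟩ − c i`, so membership in the cone `C^*(I)^+` is expressed by the conditions below. -/
noncomputable def DH (Δ : MultiFan n d) (c : Fin d → ℝ)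
    (uu : Finset (Fin d) → Fin d → (Fin n → ℝ)) (ξ : Fin n → ℝ) (u : Fin n → ℝ) : ℤ :=
  ∑ I ∈ Δ.S.filter (fun I => I.card = n),
    if (∀ i ∈ I, (0 < dotp (uu I i) ξ ∧ c i ≤ dotp u (Δ.v i)) ∨
                 (dotp (uu I i) ξ < 0 ∧ dotp u (Δ.v i) ≤ c i))
    then (-1 : ℤ) ^ (I.filter fun i => 0 < dotp (uu I i) ξ).card * Δ.w I
    else 0

/-- `uu I i = u_i^I` is the basis dual to `{v i : i ∈ I}` for each top simplex `I`. -/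
def DualBasis (Δ : MultiFan n d) (uu : Finset (Fin d) → Fin d → (Fin n → ℝ)) : Prop :=
  ∀ I ∈ Δ.S, I.card = n → ∀ i ∈ I, ∀ j ∈ I,
    dotp (uu I i) (Δ.v j) = if i = j then 1 else 0

/-- Genericity of `ξ` needed for the DH function: `⟨u_i^I, ξ⟩ ≠ 0` for all `I, i`. -/
def GenericDual (Δ : MultiFan n d) (uu : Finset (Fin d) → Fin d → (Fin n → ℝ))
    (ξ : Fin n → ℝ) : Prop :=
  ∀ I ∈ Δ.S, I.card = n → ∀ i ∈ I, dotp (uu I i) ξ ≠ 0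

end MultiFan

/-- A (simplicial) multi-fan in the lattice `N = ℤⁿ`: the ray vectors `v i` are the
primitive integral generators of the one-dimensional cones. -/
structure LMultiFan (n d : ℕ) where
  S : Finset (Finset (Fin d))
  empty_mem : ∅ ∈ S
  downClosed : ∀ I ∈ S, ∀ J ⊆ I, J ∈ S
  card_le : ∀ I ∈ S, I.card ≤ n
  v : Fin d → (Fin n → ℤ)
  indep : ∀ I ∈ S, LinearIndependent ℝ (fun i : {x // x ∈ I} => fun k => ((v i.1 k : ℝ)))
  w : Finset (Fin d) → ℤ

namespace LMultiFan

variable {n d : ℕ}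

/-- The underlying real multi-fan. -/
def toMF (Δ : LMultiFan n d) : MultiFan n d where
  S := Δ.S
  empty_mem := Δ.empty_mem
  downClosed := Δ.downClosed
  card_le := Δ.card_le
  v := fun i k => (Δ.v i k : ℝ)
  indep := Δ.indep
  w := Δ.w

/-- The vertices `u_I = ∑_{i∈I} c_i u_i^I` of the multi-polytope with constants `c` all lie
in the lattice `N^* = ℤⁿ`, i.e. the multi-polytope is a lattice multi-polytope. -/
def LatticeVertices (Δ : LMultiFan n d) (c : Fin d → ℝ)
    (uu : Finset (Fin d) → Fin d → (Fin n → ℝ)) : Prop :=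
  ∀ I ∈ Δ.S, I.card = n → ∀ k : Fin n, ∃ m : ℤ, (∑ i ∈ I, c i * uu I i k) = (m : ℝ)

/-- `♯(P) = ∑_{u ∈ N^*} DH_{P_+}(u)`, where `P_+` is the small outward enlargement of the
lattice multi-polytope `P` (each hyperplane `⟨·, v_i⟩ = c_i` is moved in the direction of
`v_i`; since all `c_i` are integers, moving by `1/2` realizes the small enlargement). -/
noncomputable def sharpP (Δ : LMultiFan n d) (c : Fin d → ℝ)
    (uu : Finset (Fin d) → Fin d → (Fin n → ℝ)) (ξ : Fin n → ℝ) : ℤ :=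
  ∑ᶠ u : Fin n → ℤ, Δ.toMF.DH (fun i => c i + 1/2) uu ξ (fun k => (u k : ℝ))

/-- `♯(P°) = ∑_{u ∈ N^*} DH_{P_−}(u)`, with `P_−` the small inward shrinking of `P`. -/
noncomputable def sharpInt (Δ : LMultiFan n d) (c : Fin d → ℝ)
    (uu : Finset (Fin d) → Fin d → (Fin n → ℝ)) (ξ : Fin n → ℝ) : ℤ :=
  ∑ᶠ u : Fin n → ℤ, Δ.toMF.DH (fun i => c i - 1/2) uu ξ (fun k => (u k : ℝ))

end LMultiFan

/-- `χ_I(x, g) = exp(2π√−1 ⟨x, v_g⟩)` for `g ∈ N/N_I` (with the canonical representative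
`v_g = g.out`); for `x ∈ N_I^*` this does not depend on the representative. -/
noncomputable def chiI {n d : ℕ} (Δ : LMultiFan n d) (I : Finset (Fin d))
    (x : Fin n → ℝ) (g : (Fin n → ℤ) ⧸ Submodule.span ℤ (Δ.v '' (I : Set (Fin d)))) : ℂ :=
  Complex.exp (2 * (Real.pi : ℂ) * Complex.I *
    ∑ k, (x k : ℂ) * ((Quotient.out g) k : ℂ))

open Finset

theorem dotp_add_right {n : ℕ} (x y z : Fin n → ℝ) : dotp x (y + z) = dotp x y + dotp x z := by
  simp [dotp, mul_add, Finset.sum_add_distrib]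

theorem dotp_smul_right {n : ℕ} (r : ℝ) (x y : Fin n → ℝ) : dotp x (r • y) = r * dotp x y := by
  simp only [dotp, Finset.mul_sum, Pi.smul_apply, smul_eq_mul]
  exact Finset.sum_congr rfl fun k _ => by ring

theorem dotp_neg_right {n : ℕ} (x y : Fin n → ℝ) : dotp x (-y) = - dotp x y := by
  simp [dotp]

theorem dotp_sum_right {n : ℕ} {ι : Type*} (s : Finset ι) (x : Fin n → ℝ) (f : ι → Fin n → ℝ) :
    dotp x (∑ i ∈ s, f i) = ∑ i ∈ s, dotp x (f i) := by
  classical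
  induction s using Finset.induction_on with
  | empty => simp [dotp]
  | insert a s ha ih => rw [Finset.sum_insert ha, Finset.sum_insert ha, dotp_add_right, ih]

theorem dotp_comm {n : ℕ} (x y : Fin n → ℝ) : dotp x y = dotp y x := by
  simp only [dotp]; exact Finset.sum_congr rfl fun k _ => by ring

theorem dotp_single_right {n : ℕ} (x : Fin n → ℝ) (k : Fin n) : dotp x (Pi.single k 1) = x k := by
  simp [dotp, Pi.single_apply]

namespace MultiFan
variable {n d : ℕ}

theorem expand1 (Δ : MultiFan n d) (uu : Finset (Fin d) → Fin d → (Fin n → ℝ))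
    (huu : Δ.DualBasis uu) {I : Finset (Fin d)} (hI : I ∈ Δ.S) (hc : I.card = n)
    (x : Fin n → ℝ) : x = ∑ i ∈ I, dotp (uu I i) x • Δ.v i := by
  have hli := Δ.indep I hI
  have hspan := hli.span_eq_top_of_card_eq_finrank' (by simp [hc])
  have hx : x ∈ Submodule.span ℝ (Set.range fun i : {x // x ∈ I} => Δ.v i.1) := by
    rw [hspan]; trivial
  obtain ⟨a, ha⟩ := (Submodule.mem_span_range_iff_exists_fun ℝ).1 hx
  have key : ∀ j : {x // x ∈ I}, dotp (uu I j.1) x = a j := by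
    intro j
    rw [← ha, dotp_sum_right]
    simp_rw [dotp_smul_right]
    rw [Finset.sum_eq_single j]
    · rw [huu I hI hc j j.2 j j.2]; simp
    · intro b _ hb
      rw [huu I hI hc j j.2 b b.2, if_neg]
      · simp
      · intro h; exact hb (Subtype.ext h.symm)
    · simp
  rw [← Finset.sum_coe_sort I (fun i => dotp (uu I i) x • Δ.v i)]
  conv_lhs => rw [← ha]
  exact Finset.sum_congr rfl fun j _ => by rw [key j]

theorem expand2 (Δ : MultiFan n d) (uu : Finset (Fin d) → Fin d → (Fin n → ℝ))
    (huu : Δ.DualBasis uu) {I : Finset (Fin d)} (hI : I ∈ Δ.S) (hc : I.card = n)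
    (u x : Fin n → ℝ) : dotp u x = ∑ i ∈ I, dotp u (Δ.v i) * dotp (uu I i) x := by
  conv_lhs => rw [Δ.expand1 uu huu hI hc x]
  rw [dotp_sum_right]
  exact Finset.sum_congr rfl fun j _ => by rw [dotp_smul_right]; ring

theorem expand3 (Δ : MultiFan n d) (uu : Finset (Fin d) → Fin d → (Fin n → ℝ))
    (huu : Δ.DualBasis uu) {I : Finset (Fin d)} (hI : I ∈ Δ.S) (hc : I.card = n)
    (u : Fin n → ℝ) (k : Fin n) : u k = ∑ i ∈ I, dotp u (Δ.v i) * uu I i k := by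
  have := Δ.expand2 uu huu hI hc u (Pi.single k 1)
  simpa only [dotp_single_right] using this

/-- pairing a dual vector with a combination of the rays -/
theorem dual_sum (Δ : MultiFan n d) (uu : Finset (Fin d) → Fin d → (Fin n → ℝ))
    (huu : Δ.DualBasis uu) {I : Finset (Fin d)} (hI : I ∈ Δ.S) (hc : I.card = n)
    {J : Finset (Fin d)} (hJ : J ⊆ I) (a : Fin d → ℝ) {i : Fin d} (hi : i ∈ I) :
    dotp (uu I i) (∑ j ∈ J, a j • Δ.v j) = if i ∈ J then a i else 0 := by
  classical
  rw [dotp_sum_right, ← Finset.sum_ite_eq J i a]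
  refine Finset.sum_congr rfl fun j hj => ?_
  rw [dotp_smul_right, huu I hI hc i hi j (hJ hj)]
  simp

theorem mem_span_iff (Δ : MultiFan n d) (uu : Finset (Fin d) → Fin d → (Fin n → ℝ))
    (huu : Δ.DualBasis uu) {I : Finset (Fin d)} (hI : I ∈ Δ.S) (hc : I.card = n)
    {i : Fin d} (hi : i ∈ I) (x : Fin n → ℝ) :
    x ∈ Submodule.span ℝ (Δ.v '' ((I.erase i : Finset (Fin d)) : Set (Fin d))) ↔
      dotp (uu I i) x = 0 := by
  classical
  constructor
  · intro h
    induction h using Submodule.span_induction with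
    | mem x hx =>
      obtain ⟨j, hj, rfl⟩ := hx
      have hj' := Finset.mem_erase.1 (Finset.mem_coe.1 hj)
      rw [huu I hI hc i hi j hj'.2, if_neg (Ne.symm hj'.1)]
    | zero => simp [dotp]
    | add x y _ _ hx hy => rw [dotp_add_right, hx, hy, add_zero]
    | smul r x _ hx => rw [dotp_smul_right, hx, mul_zero]
  · intro h
    rw [Δ.expand1 uu huu hI hc x, ← Finset.add_sum_erase I _ hi, h, zero_smul, zero_add]
    refine Submodule.sum_mem _ fun j hj => Submodule.smul_mem _ _ (Submodule.subset_span ?_)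
    exact ⟨j, Finset.mem_coe.2 hj, rfl⟩

theorem inProjCone_iff (Δ : MultiFan n d) (uu : Finset (Fin d) → Fin d → (Fin n → ℝ))
    (huu : Δ.DualBasis uu) {I : Finset (Fin d)} (hI : I ∈ Δ.S) (hc : I.card = n)
    {i : Fin d} (hi : i ∈ I) (x : Fin n → ℝ) :
    Δ.InProjCone (I.erase i) I x ↔ 0 ≤ dotp (uu I i) x := by
  classical
  have hs : I \ I.erase i = {i} := by
    ext j; simp only [mem_sdiff, mem_erase, mem_singleton]
    constructor
    · rintro ⟨h1, h2⟩; by_contra h; exact h2 ⟨h, h1⟩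
    · rintro rfl; exact ⟨hi, by simp⟩
  unfold InProjCone
  simp only [hs, mem_singleton, forall_eq, Finset.sum_singleton]
  have hone := huu I hI hc i hi i hi
  rw [if_pos rfl] at hone
  have hlin : ∀ r : ℝ, dotp (uu I i) (x - r • Δ.v i) = dotp (uu I i) x - r := by
    intro r
    rw [sub_eq_add_neg, dotp_add_right, dotp_neg_right, dotp_smul_right, hone]; ring
  constructor
  · rintro ⟨a, ha, hm⟩
    rw [Δ.mem_span_iff uu huu hI hc hi, hlin] at hm
    linarith
  · intro h
    refine ⟨fun _ => dotp (uu I i) x, h, ?_⟩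
    rw [Δ.mem_span_iff uu huu hI hc hi, hlin]; ring

end MultiFan

open Finset
namespace MultiFan
variable {n d : ℕ}

open scoped Classical in
theorem dv_eq (Δ : MultiFan n d) (uu : Finset (Fin d) → Fin d → (Fin n → ℝ))
    (huu : Δ.DualBasis uu) (J : Finset (Fin d)) (hJ : J.card + 1 = n) (x : Fin n → ℝ) :
    Δ.dv J x = ∑ I ∈ Δ.S.filter (fun I => I.card = n), ∑ i ∈ I.filter (fun i => I.erase i = J),
      if 0 ≤ dotp (uu I i) x then Δ.w I else 0 := by
  unfold dv
  rw [← Finset.filter_filter, Finset.sum_filter]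
  refine Finset.sum_congr rfl fun I hI => ?_
  obtain ⟨hIS, hc⟩ := Finset.mem_filter.1 hI
  by_cases hJI : J ⊆ I
  · have h1 : (I \ J).card = 1 := by
      rw [Finset.card_sdiff_of_subset hJI]; omega
    obtain ⟨i, hi⟩ := Finset.card_eq_one.1 h1
    have hi' : i ∈ I \ J := by rw [hi]; simp
    obtain ⟨hiI, hiJ⟩ := Finset.mem_sdiff.1 hi'
    have he : I.erase i = J := by
      rw [← Finset.sdiff_singleton_eq_erase, ← hi, Finset.sdiff_sdiff_eq_self hJI]
    have hf : I.filter (fun i => I.erase i = J) = {i} := by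
      ext k
      simp only [mem_filter, mem_singleton]
      constructor
      · rintro ⟨hk, hk'⟩
        have : k ∈ I \ J := by
          rw [Finset.mem_sdiff]; refine ⟨hk, ?_⟩; rw [← hk']; simp
        rw [hi] at this; simpa using this
      · rintro rfl; exact ⟨hiI, he⟩
    rw [hf, Finset.sum_singleton]
    have hp := Δ.inProjCone_iff uu huu hIS hc hiI x
    rw [he] at hp
    simp only [hJI, true_and, hp]
  · have hf : I.filter (fun i => I.erase i = J) = ∅ := by
      apply Finset.filter_eq_empty_iff.2
      intro k hk h
      exact hJI (h ▸ Finset.erase_subset _ _)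
    rw [hf]; simp [hJI]

open scoped Classical in
theorem wall (Δ : MultiFan n d) (hC : Δ.Complete) (uu : Finset (Fin d) → Fin d → (Fin n → ℝ))
    (huu : Δ.DualBasis uu) (J : Finset (Fin d)) (x : Fin n → ℝ) :
    ∑ I ∈ Δ.S.filter (fun I => I.card = n), ∑ i ∈ I.filter (fun i => I.erase i = J),
      Δ.w I * ((SignType.sign (dotp (uu I i) x) : SignType) : ℤ) = 0 := by
  by_cases h : ∃ I ∈ Δ.S, I.card = n ∧ ∃ i ∈ I, I.erase i = J ∧ dotp (uu I i) x ≠ 0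
  · obtain ⟨I, hI, hc, i, hi, rfl, hne⟩ := h
    have hJS : I.erase i ∈ Δ.S := Δ.downClosed I hI _ (Finset.erase_subset _ _)
    have hJc : (I.erase i).card + 1 = n := by rw [Finset.card_erase_add_one hi, hc]
    have hgen : ∀ y : Fin n → ℝ, dotp (uu I i) y ≠ 0 → Δ.GenericFor (I.erase i) y := by
      intro y hy L hL hsub hcard
      have : I.erase i = L := Finset.eq_of_subset_of_card_le hsub (by omega)
      rw [← this, Δ.mem_span_iff uu huu hI hc hi]; exact hy
    have heq := (hC _ hJS).2 x (-x) (hgen x hne) (hgen (-x) (by rw [dotp_neg_right]; simpa using hne))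
    rw [Δ.dv_eq uu huu _ hJc, Δ.dv_eq uu huu _ hJc, ← sub_eq_zero, ← Finset.sum_sub_distrib] at heq
    rw [← heq]
    refine Finset.sum_congr rfl fun I' hI' => ?_
    rw [← Finset.sum_sub_distrib]
    refine Finset.sum_congr rfl fun k hk => ?_
    obtain ⟨hIS', hc'⟩ := Finset.mem_filter.1 hI'
    obtain ⟨hk1, hk2⟩ := Finset.mem_filter.1 hk
    have hne' : dotp (uu I' k) x ≠ 0 := by
      intro h0
      rw [← Δ.mem_span_iff uu huu hIS' hc' hk1, hk2, Δ.mem_span_iff uu huu hI hc hi] at h0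
      exact hne h0
    rw [dotp_neg_right]
    rcases lt_or_gt_of_ne hne' with h | h
    · rw [sign_neg h, if_neg (by linarith), if_pos (by linarith)]; simp
    · rw [sign_pos h, if_pos (by linarith), if_neg (by linarith)]; simp
  · push Not at h
    refine Finset.sum_eq_zero fun I hI => Finset.sum_eq_zero fun i hi => ?_
    obtain ⟨hIS, hc⟩ := Finset.mem_filter.1 hI
    obtain ⟨hi1, hi2⟩ := Finset.mem_filter.1 hi
    rw [h I hIS hc i hi1 hi2]; simp

/-- sign attached to a simplex -/
noncomputable def sg (a : Fin d → ℝ) (I : Finset (Fin d)) : ℤ :=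
  ∏ i ∈ I, (-((SignType.sign (a i) : SignType) : ℤ))

open scoped Classical in
theorem wall2 (Δ : MultiFan n d) (hC : Δ.Complete) (uu : Finset (Fin d) → Fin d → (Fin n → ℝ))
    (huu : Δ.DualBasis uu) (a : Fin d → ℝ)
    (ha : ∀ I ∈ Δ.S, I.card = n → ∀ i ∈ I, a i ≠ 0) (x : Fin n → ℝ) (Q : Finset (Fin d) → Prop) :
    ∑ I ∈ Δ.S.filter (fun I => I.card = n), ∑ i ∈ I,
      (if Q (I.erase i) then
        sg a I * Δ.w I * ((SignType.sign (a i * dotp (uu I i) x) : SignType) : ℤ) else 0) = 0 := by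
  have h1 : ∀ I ∈ Δ.S.filter (fun I => I.card = n), ∀ i ∈ I, 
      (if Q (I.erase i) then
        sg a I * Δ.w I * ((SignType.sign (a i * dotp (uu I i) x) : SignType) : ℤ) else 0)
      = ∑ J : Finset (Fin d), if I.erase i = J then (if Q J then - sg a J else 0) * 
          (Δ.w I * ((SignType.sign (dotp (uu I i) x) : SignType) : ℤ)) else 0 := by
    intro I hI i hi
    obtain ⟨hIS, hc⟩ := Finset.mem_filter.1 hI
    rw [Finset.sum_ite_eq, if_pos (Finset.mem_univ _)]
    split_ifs with hQ
    · have : sg a I = -((SignType.sign (a i) : SignType) : ℤ) * sg a (I.erase i) :=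
        (Finset.mul_prod_erase I _ hi).symm
      rw [this, sign_mul]
      have h2 : ((SignType.sign (a i) : SignType) : ℤ) * ((SignType.sign (a i) : SignType) : ℤ) = 1 := by
        rcases lt_or_gt_of_ne (ha I hIS hc i hi) with h | h
        · rw [sign_neg h]; simp
        · rw [sign_pos h]; simp
      rw [SignType.coe_mul]
      linear_combination (-(sg a (I.erase i) * Δ.w I * ((SignType.sign (dotp (uu I i) x) : SignType) : ℤ))) * h2
    · simp
  rw [Finset.sum_congr rfl fun I hI => Finset.sum_congr rfl (h1 I hI)]
  have h3 : ∀ I ∈ Δ.S.filter (fun I => I.card = n), ∑ i ∈ I, 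
      (∑ J : Finset (Fin d), if I.erase i = J then (if Q J then - sg a J else 0) * 
          (Δ.w I * ((SignType.sign (dotp (uu I i) x) : SignType) : ℤ)) else 0) = 
      ∑ J : Finset (Fin d), (if Q J then - sg a J else 0) * ∑ i ∈ I.filter (fun i => I.erase i = J),
          (Δ.w I * ((SignType.sign (dotp (uu I i) x) : SignType) : ℤ)) := by
    intro I hI
    rw [Finset.sum_comm]
    refine Finset.sum_congr rfl fun J _ => ?_
    rw [Finset.mul_sum, Finset.sum_filter]
  rw [Finset.sum_congr rfl h3, Finset.sum_comm]
  refine Finset.sum_eq_zero fun J _ => ?_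
  rw [← Finset.mul_sum, Δ.wall hC uu huu J x, mul_zero]

end MultiFan

open Finset
namespace MultiFan
variable {n d : ℕ}

open scoped Classical in
noncomputable def Fterm (Δ : MultiFan n d) (uu : Finset (Fin d) → Fin d → (Fin n → ℝ))
    (a : Fin d → ℝ) (I : Finset (Fin d)) (ξ : Fin n → ℝ) : ℤ :=
  if ∀ i ∈ I, 0 < a i * dotp (uu I i) ξ then sg a I * Δ.w I else 0

theorem ev_pos_iff {α β s : ℝ} (h : α + s * β ≠ 0) :
    ∀ᶠ t in nhds s, (0 < α + t * β ↔ 0 < α + s * β) := by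
  have hcont : ContinuousAt (fun t : ℝ => α + t * β) s := by fun_prop
  rcases lt_or_gt_of_ne h with h' | h'
  · filter_upwards [hcont.eventually_lt_const h'] with t ht
    constructor <;> intro <;> linarith
  · filter_upwards [hcont.eventually_const_lt h'] with t ht
    constructor <;> intro <;> linarith

/-- the point lies in the relative interior of the flipped cone on `J` -/
def RelInt (Δ : MultiFan n d) (a : Fin d → ℝ) (x : Fin n → ℝ) (J : Finset (Fin d)) : Prop :=
  ∃ κ : Fin d → ℝ, (∀ j ∈ J, 0 < a j * κ j) ∧ x = ∑ j ∈ J, κ j • Δ.v j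

theorem relInt_iff (Δ : MultiFan n d) (uu : Finset (Fin d) → Fin d → (Fin n → ℝ))
    (huu : Δ.DualBasis uu) (a : Fin d → ℝ) {I : Finset (Fin d)} (hI : I ∈ Δ.S) (hc : I.card = n)
    {i : Fin d} (hi : i ∈ I) (x : Fin n → ℝ) : Δ.RelInt a x (I.erase i) ↔
      dotp (uu I i) x = 0 ∧ ∀ j ∈ I.erase i, 0 < a j * dotp (uu I j) x := by
  constructor
  · rintro ⟨κ, hκ, hx⟩
    have hd := fun j (hj : j ∈ I) => Δ.dual_sum uu huu hI hc (Finset.erase_subset i I) κ hj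
    rw [← hx] at hd
    refine ⟨by rw [hd i hi]; simp, fun j hj => ?_⟩
    rw [hd j (Finset.mem_of_mem_erase hj), if_pos hj]
    exact hκ j hj
  · rintro ⟨h0, hp⟩
    refine ⟨fun j => dotp (uu I j) x, hp, ?_⟩
    conv_lhs => rw [Δ.expand1 uu huu hI hc x, ← Finset.add_sum_erase I _ hi, h0, zero_smul, zero_add]

open scoped Classical in
theorem term_local (Δ : MultiFan n d) (uu : Finset (Fin d) → Fin d → (Fin n → ℝ))
    (huu : Δ.DualBasis uu) (a : Fin d → ℝ) {I : Finset (Fin d)} (hI : I ∈ Δ.S) (hc : I.card = n)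
    (ha : ∀ i ∈ I, a i ≠ 0) (x δ : Fin n → ℝ) (hx : ∀ i ∈ I, dotp (uu I i) x ≠ 0)
    (htr : ∀ i ∈ I, ∀ j ∈ I, i ≠ j → ∀ t : ℝ,
      ¬ (dotp (uu I i) (x + t • δ) = 0 ∧ dotp (uu I j) (x + t • δ) = 0)) (s : ℝ) :
    ∃ b : ℤ, ∀ᶠ t in nhdsWithin s {s}ᶜ, 2 * Δ.Fterm uu a I (x + t • δ) =
      b + (∑ i ∈ I, (if Δ.RelInt a (x + s • δ) (I.erase i) then
        sg a I * Δ.w I * ((SignType.sign (a i * dotp (uu I i) δ) : SignType) : ℤ) else 0)) *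
        ((SignType.sign (t - s) : SignType) : ℤ) := by
  have hev : ∀ i ∈ I, dotp (uu I i) (x + s • δ) ≠ 0 → ∀ᶠ t in nhdsWithin s {s}ᶜ,
      (0 < a i * dotp (uu I i) (x + t • δ) ↔ 0 < a i * dotp (uu I i) (x + s • δ)) := by
    intro i hi hne
    have heq : ∀ t : ℝ, a i * dotp (uu I i) (x + t • δ) =
        a i * dotp (uu I i) x + t * (a i * dotp (uu I i) δ) := by
      intro t; rw [dotp_add_right, dotp_smul_right]; ring
    have hne' := mul_ne_zero (ha i hi) hne
    rw [heq] at hne'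
    refine Filter.Eventually.filter_mono nhdsWithin_le_nhds ?_
    simp only [heq]
    exact ev_pos_iff hne'
  by_cases hz : ∃ i ∈ I, dotp (uu I i) (x + s • δ) = 0
  · obtain ⟨i, hi, h0⟩ := hz
    have hoth : ∀ j ∈ I, j ≠ i → dotp (uu I j) (x + s • δ) ≠ 0 := by
      intro j hj hji h; exact htr i hi j hj hji.symm s ⟨h0, h⟩
    have hsum : (∑ i ∈ I, (if Δ.RelInt a (x + s • δ) (I.erase i) then
        sg a I * Δ.w I * ((SignType.sign (a i * dotp (uu I i) δ) : SignType) : ℤ) else 0)) =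
        if Δ.RelInt a (x + s • δ) (I.erase i) then
        sg a I * Δ.w I * ((SignType.sign (a i * dotp (uu I i) δ) : SignType) : ℤ) else 0 := by
      refine Finset.sum_eq_single i (fun j hj hji => ?_) (fun h => absurd hi h)
      rw [if_neg]
      rw [Δ.relInt_iff uu huu a hI hc hj]
      exact fun h => hoth j hj hji h.1
    rw [hsum]
    have hall : ∀ᶠ t in nhdsWithin s {s}ᶜ, ∀ j ∈ I.erase i,
      (0 < a j * dotp (uu I j) (x + t • δ) ↔ 0 < a j * dotp (uu I j) (x + s • δ)) := by
      rw [Filter.eventually_all_finset]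
      intro j hj
      have hj' := Finset.mem_erase.1 hj
      exact hev j hj'.2 (hoth j hj'.2 hj'.1)
    rw [Δ.relInt_iff uu huu a hI hc hi]
    have hsplit : ∀ t : ℝ, (∀ j ∈ I, 0 < a j * dotp (uu I j) (x + t • δ)) ↔
        (0 < a i * dotp (uu I i) (x + t • δ) ∧ ∀ j ∈ I.erase i, 0 < a j * dotp (uu I j) (x + t • δ)) := by
      intro t
      constructor
      · exact fun h => ⟨h i hi, fun j hj => h j (Finset.mem_of_mem_erase hj)⟩
      · rintro ⟨h1, h2⟩ j hj
        by_cases hji : j = i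
        · rw [hji]; exact h1
        · exact h2 j (Finset.mem_erase.2 ⟨hji, hj⟩)
    by_cases hQ : ∀ j ∈ I.erase i, 0 < a j * dotp (uu I j) (x + s • δ)
    · refine ⟨sg a I * Δ.w I, ?_⟩
      rw [if_pos ⟨h0, hQ⟩]
      filter_upwards [hall, self_mem_nhdsWithin] with t ht hts
      have hts : t - s ≠ 0 := sub_ne_zero.2 hts
      have hval : a i * dotp (uu I i) (x + t • δ) = (a i * dotp (uu I i) δ) * (t - s) := by
        rw [dotp_add_right, dotp_smul_right] at h0 ⊢
        linear_combination a i * h0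
      have hb : a i * dotp (uu I i) δ ≠ 0 := by
        refine mul_ne_zero (ha i hi) fun hb => ?_
        rw [dotp_add_right, dotp_smul_right, hb] at h0
        exact hx i hi (by simpa using h0)
      unfold Fterm
      simp only [hsplit t, hval]
      have hQt : ∀ j ∈ I.erase i, 0 < a j * dotp (uu I j) (x + t • δ) :=
        fun j hj => (ht j hj).2 (hQ j hj)
      rw [mul_assoc (sg a I * Δ.w I), ← SignType.coe_mul, ← sign_mul]
      rcases lt_or_gt_of_ne (mul_ne_zero hb hts) with h | h
      · rw [sign_neg h, if_neg (fun hh => absurd hh.1 (not_lt.2 h.le))]; simp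
      · rw [sign_pos h, if_pos ⟨h, hQt⟩]; simp; ring
    · refine ⟨0, ?_⟩
      rw [if_neg (fun h => hQ h.2)]
      filter_upwards [hall] with t ht
      unfold Fterm
      simp only [hsplit t]
      rw [if_neg]
      · simp
      · exact fun h => hQ fun j hj => (ht j hj).1 (h.2 j hj)
  · push Not at hz
    refine ⟨2 * Δ.Fterm uu a I (x + s • δ), ?_⟩
    rw [Finset.sum_eq_zero]
    · have hall : ∀ᶠ t in nhdsWithin s {s}ᶜ, ∀ j ∈ I,
        (0 < a j * dotp (uu I j) (x + t • δ) ↔ 0 < a j * dotp (uu I j) (x + s • δ)) := by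
        rw [Filter.eventually_all_finset]
        exact fun j hj => hev j hj (hz j hj)
      filter_upwards [hall] with t ht
      have : (∀ j ∈ I, 0 < a j * dotp (uu I j) (x + t • δ)) ↔ 
        (∀ j ∈ I, 0 < a j * dotp (uu I j) (x + s • δ)) := forall₂_congr ht
      unfold Fterm
      simp only [this]; simp
    · intro i hi
      rw [if_neg]
      rw [Δ.relInt_iff uu huu a hI hc hi]
      exact fun h => hz i hi h.1

theorem const_of_local (f : ℝ → ℤ) (h : ∀ s, ∃ k, ∀ᶠ t in nhdsWithin s {s}ᶜ, f t = k)
    (x y : ℝ) (hx : ∀ᶠ t in nhds x, f t = f x) (hy : ∀ᶠ t in nhds y, f t = f y) : f x = f y := by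
  choose k hk using h
  have hkey : ∀ s m, (∀ᶠ t in nhdsWithin s {s}ᶜ, f t = m) → k s = m := by
    intro s m hm
    obtain ⟨t, h1, h2⟩ := ((hk s).and hm).exists
    exact h1.symm.trans h2
  have hloc : IsLocallyConstant k := by
    rw [IsLocallyConstant.iff_eventually_eq]
    intro s
    have h1 := hk s
    rw [eventually_nhdsWithin_iff] at h1
    filter_upwards [h1.eventually_nhds] with t ht
    by_cases hts : t = s
    · rw [hts]
    · apply hkey
      have h3 : ∀ᶠ r in nhds t, r ∈ ({s}ᶜ : Set ℝ) := isOpen_compl_singleton.mem_nhds hts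
      filter_upwards [nhdsWithin_le_nhds ht, nhdsWithin_le_nhds h3] with r hr hr'
      exact hr hr'
  rw [← hkey x (f x) (nhdsWithin_le_nhds hx), ← hkey y (f y) (nhdsWithin_le_nhds hy)]
  exact hloc.apply_eq_of_preconnectedSpace x y

noncomputable def Fsum (Δ : MultiFan n d) (uu : Finset (Fin d) → Fin d → (Fin n → ℝ))
    (a : Fin d → ℝ) (ξ : Fin n → ℝ) : ℤ :=
  ∑ I ∈ Δ.S.filter (fun I => I.card = n), Δ.Fterm uu a I ξ

theorem Fsum_local (Δ : MultiFan n d) (hC : Δ.Complete) (uu : Finset (Fin d) → Fin d → (Fin n → ℝ))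
    (huu : Δ.DualBasis uu) (a : Fin d → ℝ)
    (ha : ∀ I ∈ Δ.S, I.card = n → ∀ i ∈ I, a i ≠ 0) (x δ : Fin n → ℝ) (hx : Δ.GenericDual uu x)
    (htr : ∀ I ∈ Δ.S, I.card = n → ∀ i ∈ I, ∀ j ∈ I, i ≠ j → ∀ t : ℝ,
      ¬ (dotp (uu I i) (x + t • δ) = 0 ∧ dotp (uu I j) (x + t • δ) = 0)) (s : ℝ) :
    ∃ k, ∀ᶠ t in nhdsWithin s {s}ᶜ, Δ.Fsum uu a (x + t • δ) = k := by
  classical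
  have h1 : ∀ I : Finset (Fin d), ∃ b : ℤ, I ∈ Δ.S.filter (fun I => I.card = n) → 
    ∀ᶠ t in nhdsWithin s {s}ᶜ, 2 * Δ.Fterm uu a I (x + t • δ) =
      b + (∑ i ∈ I, (if Δ.RelInt a (x + s • δ) (I.erase i) then
        sg a I * Δ.w I * ((SignType.sign (a i * dotp (uu I i) δ) : SignType) : ℤ) else 0)) *
        ((SignType.sign (t - s) : SignType) : ℤ) := by
    intro I
    by_cases hI : I ∈ Δ.S.filter (fun I => I.card = n)
    · obtain ⟨hIS, hc⟩ := Finset.mem_filter.1 hI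
      obtain ⟨b, hb⟩ := Δ.term_local uu huu a hIS hc (ha I hIS hc) x δ (hx I hIS hc) (htr I hIS hc) s
      exact ⟨b, fun _ => hb⟩
    · exact ⟨0, fun h => absurd h hI⟩
  choose b hb using h1
  have h2 := (Filter.eventually_all_finset (Δ.S.filter (fun I => I.card = n))).2 hb
  have h3 : ∀ᶠ t in nhdsWithin s {s}ᶜ, 2 * Δ.Fsum uu a (x + t • δ) =
      ∑ I ∈ Δ.S.filter (fun I => I.card = n), b I := by
    filter_upwards [h2] with t ht
    unfold Fsum
    rw [Finset.mul_sum, Finset.sum_congr rfl ht, Finset.sum_add_distrib, ← Finset.sum_mul,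
      Δ.wall2 hC uu huu a ha δ]
    simp
  refine ⟨(∑ I ∈ Δ.S.filter (fun I => I.card = n), b I) / 2, ?_⟩
  filter_upwards [h3] with t ht
  omega

theorem Fsum_local_generic (Δ : MultiFan n d) (uu : Finset (Fin d) → Fin d → (Fin n → ℝ))
    (a : Fin d → ℝ)
    (ha : ∀ I ∈ Δ.S, I.card = n → ∀ i ∈ I, a i ≠ 0) (x δ : Fin n → ℝ) (s : ℝ)
    (hx : Δ.GenericDual uu (x + s • δ)) :
    ∀ᶠ t in nhds s, Δ.Fsum uu a (x + t • δ) = Δ.Fsum uu a (x + s • δ) := by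
  have h : ∀ I ∈ Δ.S.filter (fun I => I.card = n), ∀ᶠ t in nhds s, ∀ i ∈ I,
      (0 < a i * dotp (uu I i) (x + t • δ) ↔ 0 < a i * dotp (uu I i) (x + s • δ)) := by
    intro I hI
    obtain ⟨hIS, hc⟩ := Finset.mem_filter.1 hI
    rw [Filter.eventually_all_finset]
    intro i hi
    have heq : ∀ t : ℝ, a i * dotp (uu I i) (x + t • δ) =
        a i * dotp (uu I i) x + t * (a i * dotp (uu I i) δ) := by
      intro t; rw [dotp_add_right, dotp_smul_right]; ring
    have hne' := mul_ne_zero (ha I hIS hc i hi) (hx I hIS hc i hi)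
    rw [heq] at hne'
    simp only [heq]
    exact ev_pos_iff hne'
  rw [← Filter.eventually_all_finset] at h
  filter_upwards [h] with t ht
  refine Finset.sum_congr rfl fun I hI => ?_
  have : (∀ j ∈ I, 0 < a j * dotp (uu I j) (x + t • δ)) ↔ 
        (∀ j ∈ I, 0 < a j * dotp (uu I j) (x + s • δ)) := forall₂_congr (ht I hI)
  unfold Fterm
  simp only [this]

/-- `η` is transversal to `x` -/
def Transv (Δ : MultiFan n d) (uu : Finset (Fin d) → Fin d → (Fin n → ℝ)) (x η : Fin n → ℝ) : Prop :=
  ∀ I ∈ Δ.S, I.card = n → ∀ i ∈ I, ∀ j ∈ I, i ≠ j →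
    dotp (uu I i) x * dotp (uu I j) η - dotp (uu I j) x * dotp (uu I i) η ≠ 0

theorem Fsum_const_of_transv (Δ : MultiFan n d) (hC : Δ.Complete)
    (uu : Finset (Fin d) → Fin d → (Fin n → ℝ))
    (huu : Δ.DualBasis uu) (a : Fin d → ℝ)
    (ha : ∀ I ∈ Δ.S, I.card = n → ∀ i ∈ I, a i ≠ 0) (x η : Fin n → ℝ) (hx : Δ.GenericDual uu x)
    (hη : Δ.GenericDual uu η) (ht : Δ.Transv uu x η) : Δ.Fsum uu a x = Δ.Fsum uu a η := by
  have e0 : x + (0:ℝ) • (η - x) = x := by simp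
  have e1 : x + (1:ℝ) • (η - x) = η := by simp
  have := const_of_local (fun t => Δ.Fsum uu a (x + t • (η - x)))
    (Δ.Fsum_local hC uu huu a ha x (η - x) hx ?_) 0 1
    (Δ.Fsum_local_generic uu a ha x (η - x) 0 (by rwa [e0]))
    (Δ.Fsum_local_generic uu a ha x (η - x) 1 (by rwa [e1]))
  · simpa only [e0, e1] using this
  · rintro I hI hc i hi j hj hij t ⟨h1, h2⟩
    apply ht I hI hc i hi j hj hij
    rw [sub_eq_add_neg, dotp_add_right, dotp_smul_right, dotp_add_right, dotp_neg_right] at h1 h2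
    have hxi := hx I hI hc i hi
    by_cases ht0 : t = 0
    · rw [ht0] at h1; exact absurd (by simpa using h1) hxi
    · have : t * (dotp (uu I i) x * dotp (uu I j) η - dotp (uu I j) x * dotp (uu I i) η) = 0 := by
        linear_combination dotp (uu I i) x * h2 - dotp (uu I j) x * h1
      exact (mul_eq_zero.1 this).resolve_left ht0

end MultiFan

open Finset
namespace MultiFan
variable {n d : ℕ}

theorem exists_avoid {ι : Type*} [Finite ι] (p : ι → (Fin n → ℝ)) :
    ∃ η : Fin n → ℝ, ∀ i, (∃ x, dotp (p i) x ≠ 0) → dotp (p i) η ≠ 0 := by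
  let f : {i // ∃ x, dotp (p i) x ≠ 0} → Module.Dual ℝ (Fin n → ℝ) := fun i =>
    { toFun := fun x => dotp (p i.1) x
      map_add' := fun x y => dotp_add_right _ x y
      map_smul' := fun r x => dotp_smul_right r _ x }
  obtain ⟨η, hη⟩ := Module.Dual.exists_forall_ne_zero_of_forall_exists f (fun i => i.2)
  exact ⟨η, fun i hi => hη ⟨i, hi⟩⟩

theorem dotp_comb {n : ℕ} (r s : ℝ) (p q x : Fin n → ℝ) :
    dotp (r • p - s • q) x = r * dotp p x - s * dotp q x := by
  rw [dotp_comm, sub_eq_add_neg, dotp_add_right, dotp_neg_right, dotp_smul_right, dotp_smul_right,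
    dotp_comm x p, dotp_comm x q]; ring

theorem exists_transv (Δ : MultiFan n d)
    (uu : Finset (Fin d) → Fin d → (Fin n → ℝ))
    (huu : Δ.DualBasis uu) (x y : Fin n → ℝ) (hx : Δ.GenericDual uu x) (hy : Δ.GenericDual uu y) :
    ∃ η, Δ.GenericDual uu η ∧ Δ.Transv uu x η ∧ Δ.Transv uu y η := by
  let K := Finset (Fin d) × Fin d × Fin d
  let p : K ⊕ K ⊕ K → (Fin n → ℝ) := fun k => match k with
    | .inl k => uu k.1 k.2.1
    | .inr (.inl k) => dotp (uu k.1 k.2.1) x • uu k.1 k.2.2 - dotp (uu k.1 k.2.2) x • uu k.1 k.2.1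
    | .inr (.inr k) => dotp (uu k.1 k.2.1) y • uu k.1 k.2.2 - dotp (uu k.1 k.2.2) y • uu k.1 k.2.1
  obtain ⟨η, hη⟩ := exists_avoid p
  refine ⟨η, ?_, ?_, ?_⟩
  · intro I hI hc i hi
    refine hη (.inl (I, i, i)) ⟨Δ.v i, ?_⟩
    change dotp (uu I i) (Δ.v i) ≠ 0
    rw [huu I hI hc i hi i hi]; simp
  · intro I hI hc i hi j hj hij
    rw [← dotp_comb]
    refine hη (.inr (.inl (I, i, j))) ⟨Δ.v j, ?_⟩
    change dotp (dotp (uu I i) x • uu I j - dotp (uu I j) x • uu I i) (Δ.v j) ≠ 0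
    rw [dotp_comb, huu I hI hc j hj j hj, huu I hI hc i hi j hj, if_neg hij]
    simpa using hx I hI hc i hi
  · intro I hI hc i hi j hj hij
    rw [← dotp_comb]
    refine hη (.inr (.inr (I, i, j))) ⟨Δ.v j, ?_⟩
    change dotp (dotp (uu I i) y • uu I j - dotp (uu I j) y • uu I i) (Δ.v j) ≠ 0
    rw [dotp_comb, huu I hI hc j hj j hj, huu I hI hc i hi j hj, if_neg hij]
    simpa using hy I hI hc i hi

theorem Fsum_const (Δ : MultiFan n d) (hC : Δ.Complete)
    (uu : Finset (Fin d) → Fin d → (Fin n → ℝ))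
    (huu : Δ.DualBasis uu) (a : Fin d → ℝ)
    (ha : ∀ I ∈ Δ.S, I.card = n → ∀ i ∈ I, a i ≠ 0) (x y : Fin n → ℝ) (hx : Δ.GenericDual uu x)
    (hy : Δ.GenericDual uu y) : Δ.Fsum uu a x = Δ.Fsum uu a y := by
  obtain ⟨η, h1, h2, h3⟩ := Δ.exists_transv uu huu x y hx hy
  rw [Δ.Fsum_const_of_transv hC uu huu a ha x η hx h1 h2,
    Δ.Fsum_const_of_transv hC uu huu a ha y η hy h1 h3]

theorem DH_eq_Fsum (Δ : MultiFan n d) (c : Fin d → ℝ)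
    (uu : Finset (Fin d) → Fin d → (Fin n → ℝ)) (ξ u : Fin n → ℝ)
    (ha : ∀ I ∈ Δ.S, I.card = n → ∀ i ∈ I, dotp u (Δ.v i) - c i ≠ 0) (hξ : Δ.GenericDual uu ξ) :
    Δ.DH c uu ξ u = Δ.Fsum uu (fun i => dotp u (Δ.v i) - c i) ξ := by
  classical
  unfold DH Fsum
  refine Finset.sum_congr rfl fun I hI => ?_
  obtain ⟨hIS, hc⟩ := Finset.mem_filter.1 hI
  have hiff : (∀ i ∈ I, (0 < dotp (uu I i) ξ ∧ c i ≤ dotp u (Δ.v i)) ∨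
                 (dotp (uu I i) ξ < 0 ∧ dotp u (Δ.v i) ≤ c i)) ↔
      (∀ i ∈ I, 0 < (dotp u (Δ.v i) - c i) * dotp (uu I i) ξ) := by
    refine forall₂_congr fun i hi => ?_
    have h1 := ha I hIS hc i hi
    rw [mul_pos_iff]
    constructor
    · rintro (⟨h2, h3⟩ | ⟨h2, h3⟩)
      · exact Or.inl ⟨lt_of_le_of_ne (by linarith) h1.symm, h2⟩
      · exact Or.inr ⟨lt_of_le_of_ne (by linarith) h1, h2⟩
    · rintro (⟨h2, h3⟩ | ⟨h2, h3⟩)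
      · exact Or.inl ⟨h3, by linarith⟩
      · exact Or.inr ⟨h3, by linarith⟩
  unfold Fterm
  by_cases h : ∀ i ∈ I, 0 < (dotp u (Δ.v i) - c i) * dotp (uu I i) ξ
  · rw [if_pos (hiff.2 h), if_pos h]
    congr 1
    rw [← Finset.prod_const, Finset.prod_filter]
    unfold sg
    refine Finset.prod_congr rfl fun i hi => ?_
    rcases mul_pos_iff.1 (h i hi) with ⟨h2, h3⟩ | ⟨h2, h3⟩
    · rw [if_pos h3, sign_pos h2]; simp
    · rw [if_neg (not_lt.2 h3.le), sign_neg h2]; simp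
  · rw [if_neg (fun hh => h (hiff.1 hh)), if_neg h]

theorem DH_const (Δ : MultiFan n d) (hC : Δ.Complete) (c : Fin d → ℝ)
    (uu : Finset (Fin d) → Fin d → (Fin n → ℝ)) (huu : Δ.DualBasis uu) (ξ η u : Fin n → ℝ)
    (ha : ∀ I ∈ Δ.S, I.card = n → ∀ i ∈ I, dotp u (Δ.v i) - c i ≠ 0) (hξ : Δ.GenericDual uu ξ)
    (hη : Δ.GenericDual uu η) : Δ.DH c uu ξ u = Δ.DH c uu η u := by
  rw [Δ.DH_eq_Fsum c uu ξ u ha hξ, Δ.DH_eq_Fsum c uu η u ha hη]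
  exact Δ.Fsum_const hC uu huu _ ha ξ η hξ hη

/-- a lower bound for the pairing with `η` on the support -/
theorem DH_bound (Δ : MultiFan n d) (c : Fin d → ℝ)
    (uu : Finset (Fin d) → Fin d → (Fin n → ℝ)) (huu : Δ.DualBasis uu) (η : Fin n → ℝ) :
    ∃ B : ℝ, ∀ u, Δ.DH c uu η u ≠ 0 → -B ≤ dotp u η := by
  classical
  refine ⟨∑ I ∈ Δ.S.filter (fun I => I.card = n), |∑ i ∈ I, c i * dotp (uu I i) η|, fun u hu => ?_⟩
  unfold DH at hu
  obtain ⟨I, hI, hne⟩ := Finset.exists_ne_zero_of_sum_ne_zero hu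
  obtain ⟨hIS, hc⟩ := Finset.mem_filter.1 hI
  have hcond := (ite_ne_right_iff.1 hne).1
  rw [Δ.expand2 uu huu hIS hc u η]
  have h1 : ∑ i ∈ I, c i * dotp (uu I i) η ≤ ∑ i ∈ I, dotp u (Δ.v i) * dotp (uu I i) η := by
    refine Finset.sum_le_sum fun i hi => ?_
    rcases hcond i hi with ⟨h2, h3⟩ | ⟨h2, h3⟩
    · exact mul_le_mul_of_nonneg_right h3 h2.le
    · exact mul_le_mul_of_nonpos_right h3 h2.le
  have h2 := Finset.single_le_sum (f := fun I => |∑ i ∈ I, c i * dotp (uu I i) η|)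
    (fun I _ => abs_nonneg _) hI
  have h3 := neg_abs_le (∑ i ∈ I, c i * dotp (uu I i) η)
  linarith

theorem genericDual_neg (Δ : MultiFan n d) (uu : Finset (Fin d) → Fin d → (Fin n → ℝ))
    (η : Fin n → ℝ) (h : Δ.GenericDual uu η) : Δ.GenericDual uu (-η) := by
  intro I hI hc i hi
  rw [dotp_neg_right]; exact neg_ne_zero.2 (h I hI hc i hi)

theorem exists_perturb (Δ : MultiFan n d) (uu : Finset (Fin d) → Fin d → (Fin n → ℝ))
    (η y : Fin n → ℝ) (h : Δ.GenericDual uu η) :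
    ∃ s : ℝ, s ≠ 0 ∧ Δ.GenericDual uu (η + s • y) := by
  have h1 : ∀ᶠ s in nhds (0:ℝ), Δ.GenericDual uu (η + s • y) := by
    unfold GenericDual
    rw [Filter.eventually_all_finset]
    intro I hI
    rw [Filter.eventually_all]
    intro hc
    rw [Filter.eventually_all_finset]
    intro i hi
    have hcont : ContinuousAt (fun s : ℝ => dotp (uu I i) (η + s • y)) 0 := by
      simp only [dotp_add_right, dotp_smul_right]; fun_prop
    refine hcont.eventually_ne ?_
    simpa using h I hI hc i hi
  have h2 : ∀ᶠ s in nhdsWithin (0:ℝ) {0}ᶜ, Δ.GenericDual uu (η + s • y) := nhdsWithin_le_nhds h1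
  obtain ⟨s, hs, hs'⟩ := (h2.and self_mem_nhdsWithin).exists
  exact ⟨s, hs', hs⟩

theorem DH_finite (Δ : MultiFan n d) (hC : Δ.Complete) (c : Fin d → ℝ)
    (uu : Finset (Fin d) → Fin d → (Fin n → ℝ)) (huu : Δ.DualBasis uu) (ξ : Fin n → ℝ)
    (hξ : Δ.GenericDual uu ξ)
    (ha : ∀ u : Fin n → ℤ, ∀ I ∈ Δ.S, I.card = n → ∀ i ∈ I,
      dotp (fun k => (u k : ℝ)) (Δ.v i) - c i ≠ 0) :
    {u : Fin n → ℤ | Δ.DH c uu ξ (fun k => (u k : ℝ)) ≠ 0}.Finite := by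
  have hb : ∀ η, Δ.GenericDual uu η → ∃ B : ℝ, ∀ u : Fin n → ℤ,
      Δ.DH c uu ξ (fun k => (u k : ℝ)) ≠ 0 → |dotp (fun k => (u k : ℝ)) η| ≤ B := by
    intro η hη
    obtain ⟨B1, h1⟩ := Δ.DH_bound c uu huu η
    obtain ⟨B2, h2⟩ := Δ.DH_bound c uu huu (-η)
    refine ⟨max B1 B2, fun u hu => ?_⟩
    have g1 := h1 _ (by rwa [← Δ.DH_const hC c uu huu ξ η _ (ha u) hξ hη])
    have g2 := h2 _ (by rwa [← Δ.DH_const hC c uu huu ξ (-η) _ (ha u) hξ (Δ.genericDual_neg uu η hη)])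
    rw [dotp_neg_right] at g2
    rw [abs_le]
    constructor
    · linarith [le_max_left B1 B2]
    · linarith [le_max_right B1 B2]
  have hk : ∀ k : Fin n, ∃ B : ℝ, ∀ u : Fin n → ℤ,
      Δ.DH c uu ξ (fun k => (u k : ℝ)) ≠ 0 → |(u k : ℝ)| ≤ B := by
    intro k
    obtain ⟨s, hs, hs'⟩ := Δ.exists_perturb uu ξ (Pi.single k 1) hξ
    obtain ⟨B1, h1⟩ := hb ξ hξ
    obtain ⟨B2, h2⟩ := hb _ hs'
    refine ⟨(B1 + B2) / |s|, fun u hu => ?_⟩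
    have g1 := h1 u hu
    have g2 := h2 u hu
    rw [dotp_add_right, dotp_smul_right, dotp_single_right] at g2
    rw [le_div_iff₀ (abs_pos.2 hs), mul_comm, ← abs_mul]
    rw [abs_le] at *
    constructor <;> linarith [g1.1, g1.2, g2.1, g2.2]
  choose B hB using hk
  refine (Set.Finite.pi' (fun k : Fin n => Set.finite_Icc (-⌈B k⌉) ⌈B k⌉)).subset ?_
  intro u hu k
  have h := abs_le.1 (hB k u hu)
  have h4 := Int.le_ceil (B k)
  rw [Set.mem_Icc]
  constructor
  · have : (-(⌈B k⌉ : ℝ)) ≤ u k := by linarith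
    exact_mod_cast this
  · have : (u k : ℝ) ≤ ⌈B k⌉ := by linarith
    exact_mod_cast this

end MultiFan

open Finset

theorem hs_congr {β : Type*} {f g : β → ℂ} {a b : ℂ} (h : HasSum f a) (hf : ∀ x, g x = f x)
    (hab : b = a) : HasSum g b := by
  have : g = f := funext hf
  rw [this, hab]; exact h

theorem hasSum_pi_fin (m : ℕ) (f : Fin m → ℤ → ℂ) (a : Fin m → ℂ) (h : ∀ i, HasSum (f i) (a i)) :
    HasSum (fun x : Fin m → ℤ => ∏ i, f i (x i)) (∏ i, a i) := by
  induction m with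
  | zero =>
    simp only [Finset.univ_eq_empty, Finset.prod_empty]
    have := hasSum_unique (fun _ : Fin 0 → ℤ => (1 : ℂ))
    exact this
  | succ m ih =>
    have ih' := ih (fun i => f i.succ) (fun i => a i.succ) (fun i => h i.succ)
    have hs := summable_mul_of_summable_norm (h 0).summable.norm ih'.summable.norm
    have hm := (h 0).mul ih' hs
    rw [← (Fin.consEquiv (fun _ : Fin (m + 1) => ℤ)).hasSum_iff, Fin.prod_univ_succ]
    refine hs_congr hm (fun p => ?_) rfl
    simp [Fin.prod_univ_succ, Fin.consEquiv]

theorem hasSum_pi_prod {ι : Type*} [Fintype ι] (f : ι → ℤ → ℂ) (a : ι → ℂ)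
    (h : ∀ i, HasSum (f i) (a i)) :
    HasSum (fun x : ι → ℤ => ∏ i, f i (x i)) (∏ i, a i) := by
  classical
  let e := Fintype.equivFin ι
  have := hasSum_pi_fin _ (fun j => f (e.symm j)) (fun j => a (e.symm j)) (fun j => h _)
  rw [← (e.arrowCongr (Equiv.refl ℤ)).hasSum_iff] at this
  convert this using 1
  · funext x
    rw [← Equiv.prod_comp e.symm]
    simp [Equiv.arrowCongr]
  · rw [← Equiv.prod_comp e.symm]

theorem hasSum_geo_pos (q : ℂ) (hq : ‖q‖ < 1) (hq0 : q ≠ 0) :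
    HasSum (fun k : ℤ => if 1 ≤ k then q ^ k else 0) (-(1 - q⁻¹)⁻¹) := by
  have hinj : Function.Injective (fun k : ℕ => (k : ℤ) + 1) := fun a b h => by
    simp only at h; omega
  rw [← hinj.hasSum_iff]
  · have h1 : q ≠ 1 := by rintro rfl; simp at hq
    have := (hasSum_geometric_of_norm_lt_one hq).mul_left q
    refine hs_congr this (fun k => ?_) ?_
    · simp only [Function.comp]
      rw [if_pos (by omega), zpow_add₀ hq0, zpow_natCast]; simp [mul_comm]
    · have h2 : 1 - q ≠ 0 := sub_ne_zero.2 h1.symm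
      have h3 : q - 1 ≠ 0 := sub_ne_zero.2 h1
      have h4 : 1 - q⁻¹ = (q - 1) / q := by field_simp
      rw [h4, inv_div, ← neg_sub 1 q]
      field_simp
  · intro k hk
    rw [if_neg]
    intro h
    exact hk ⟨(k - 1).toNat, by simp only; omega⟩

theorem hasSum_geo_neg (q : ℂ) (hq : 1 < ‖q‖) :
    HasSum (fun k : ℤ => if k ≤ 0 then q ^ k else 0) ((1 - q⁻¹)⁻¹) := by
  have hinj : Function.Injective (fun k : ℕ => -(k : ℤ)) := fun a b h => by
    simp only at h; omega
  rw [← hinj.hasSum_iff]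
  · have hq' : ‖q⁻¹‖ < 1 := by rw [norm_inv]; exact inv_lt_one_of_one_lt₀ hq
    refine hs_congr (hasSum_geometric_of_norm_lt_one hq') (fun k => ?_) rfl
    simp only [Function.comp]
    rw [if_pos (by omega), zpow_neg, zpow_natCast, inv_pow]
  · intro k hk
    rw [if_neg]
    intro h
    exact hk ⟨(-k).toNat, by simp only; omega⟩

theorem norm_zpow_lt (z : ℂ) (hz : z ≠ 0) (h : ‖z‖ < 1) (e : ℤ) (he : 0 < e) : ‖z ^ e‖ < 1 := by
  lift e to ℕ using he.le
  rw [zpow_natCast, norm_pow]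
  exact pow_lt_one₀ (norm_nonneg _) h (by omega)

theorem norm_zpow_gt (z : ℂ) (hz : z ≠ 0) (h : ‖z‖ < 1) (e : ℤ) (he : e < 0) : 1 < ‖z ^ e‖ := by
  have := norm_zpow_lt z hz h (-e) (by omega)
  rw [zpow_neg, norm_inv] at this
  have hp : 0 < ‖z ^ e‖ := norm_pos_iff.2 (zpow_ne_zero _ hz)
  exact (inv_lt_one₀ hp).1 this

namespace LMultiFan
variable {n d : ℕ}

theorem finite_quot (Δ : LMultiFan n d) {I : Finset (Fin d)} (hI : I ∈ Δ.S) (hc : I.card = n) :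
    Finite ((Fin n → ℤ) ⧸ Submodule.span ℤ (Δ.v '' (I : Set (Fin d)))) := by
  apply Submodule.finiteQuotientOfFreeOfRankEq
  have hli : LinearIndependent ℤ (fun i : {x // x ∈ I} => Δ.v i.1) := by
    have h := Δ.indep I hI
    rw [Fintype.linearIndependent_iff] at h ⊢
    intro g hg i
    have := h (fun i => (g i : ℝ)) ?_ i
    · exact_mod_cast this
    · funext k
      have hk := congrFun hg k
      simp only [Finset.sum_apply, Pi.smul_apply, smul_eq_mul, Pi.zero_apply] at hk ⊢
      exact_mod_cast hk
  have hr : Δ.v '' (I : Set (Fin d)) = Set.range (fun i : {x // x ∈ I} => Δ.v i.1) := by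
    ext y; simp
  rw [hr, finrank_span_eq_card hli]
  simp [hc]

theorem pair_int (Δ : LMultiFan n d) (I : Finset (Fin d)) (x : Fin n → ℝ)
    (hx : ∀ i ∈ I, ∃ m : ℤ, dotp x (fun k => (Δ.v i k : ℝ)) = m) (y : Fin n → ℤ)
    (hy : y ∈ Submodule.span ℤ (Δ.v '' (I : Set (Fin d)))) :
    ∃ m : ℤ, dotp x (fun k => (y k : ℝ)) = m := by
  induction hy using Submodule.span_induction with
  | mem y hy => obtain ⟨i, hi, rfl⟩ := hy; exact hx i hi
  | zero => exact ⟨0, by simp [dotp]⟩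
  | add y z _ _ hy hz =>
    obtain ⟨a, ha⟩ := hy; obtain ⟨b, hb⟩ := hz
    refine ⟨a + b, ?_⟩
    push_cast; rw [← ha, ← hb, ← dotp_add_right]; congr 1; funext k; simp
  | smul r y _ hy =>
    obtain ⟨a, ha⟩ := hy
    refine ⟨r * a, ?_⟩
    push_cast; rw [← ha, ← dotp_smul_right]; congr 1; funext k; simp

theorem chiI_eq (Δ : LMultiFan n d) (I : Finset (Fin d)) (x : Fin n → ℝ)
    (g : (Fin n → ℤ) ⧸ Submodule.span ℤ (Δ.v '' (I : Set (Fin d)))) :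
    chiI Δ I x g = Complex.exp (2 * (Real.pi : ℂ) * Complex.I *
      (dotp x (fun k => ((Quotient.out g) k : ℝ)) : ℝ)) := by
  unfold chiI dotp; push_cast; rfl

theorem norm_chiI (Δ : LMultiFan n d) (I : Finset (Fin d)) (x : Fin n → ℝ)
    (g : (Fin n → ℤ) ⧸ Submodule.span ℤ (Δ.v '' (I : Set (Fin d)))) :
    ‖chiI Δ I x g‖ = 1 := by
  rw [chiI_eq, ← Complex.norm_exp_ofReal_mul_I (2 * Real.pi * dotp x (fun k => ((Quotient.out g) k : ℝ)))]
  congr 2; push_cast; ring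

theorem exp_eq_of_int (a b : ℝ) (h : ∃ m : ℤ, a - b = m) :
    Complex.exp (2 * (Real.pi : ℂ) * Complex.I * (a : ℝ)) =
    Complex.exp (2 * (Real.pi : ℂ) * Complex.I * (b : ℝ)) := by
  obtain ⟨m, hm⟩ := h
  rw [Complex.exp_eq_exp_iff_exists_int]
  refine ⟨m, ?_⟩
  have : (a : ℂ) = b + m := by
    have : a = b + m := by linarith
    rw [this]; push_cast; ring
  rw [this]; ring

theorem chiI_mk (Δ : LMultiFan n d) (I : Finset (Fin d)) (x : Fin n → ℝ)
    (hx : ∀ i ∈ I, ∃ m : ℤ, dotp x (fun k => (Δ.v i k : ℝ)) = m) (y : Fin n → ℤ) :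
    chiI Δ I x (Submodule.Quotient.mk y) = Complex.exp (2 * (Real.pi : ℂ) * Complex.I *
      (dotp x (fun k => (y k : ℝ)) : ℝ)) := by
  rw [chiI_eq]
  apply exp_eq_of_int
  have hmem : (Quotient.out (Submodule.Quotient.mk y : (Fin n → ℤ) ⧸ Submodule.span ℤ (Δ.v '' (I : Set (Fin d))))) - y
      ∈ Submodule.span ℤ (Δ.v '' (I : Set (Fin d))) := by
    rw [← Submodule.Quotient.eq]
    exact Quotient.out_eq _
  obtain ⟨m, hm⟩ := pair_int Δ I x hx _ hmem
  refine ⟨m, ?_⟩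
  rw [← hm, sub_eq_add_neg, ← dotp_neg_right, ← dotp_add_right]
  congr 1; funext k; simp; ring

theorem orth (Δ : LMultiFan n d) (I : Finset (Fin d)) 
    [Fintype ((Fin n → ℤ) ⧸ Submodule.span ℤ (Δ.v '' (I : Set (Fin d))))] (x : Fin n → ℝ)
    [Decidable (∀ k, ∃ m : ℤ, x k = m)]
    (hx : ∀ i ∈ I, ∃ m : ℤ, dotp x (fun k => (Δ.v i k : ℝ)) = m) :
    ∑ g, chiI Δ I x g = if ∀ k, ∃ m : ℤ, x k = m then
      (Nat.card ((Fin n → ℤ) ⧸ Submodule.span ℤ (Δ.v '' (I : Set (Fin d)))) : ℂ) else 0 := by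
  classical
  let ψ : AddChar ((Fin n → ℤ) ⧸ Submodule.span ℤ (Δ.v '' (I : Set (Fin d)))) ℂ :=
    { toFun := chiI Δ I x
      map_zero_eq_one' := by
        rw [← Submodule.Quotient.mk_zero, chiI_mk Δ I x hx]; simp [dotp]
      map_add_eq_mul' := by
        intro g h
        induction g using Submodule.Quotient.induction_on with | _ g =>
        induction h using Submodule.Quotient.induction_on with | _ h =>
        rw [← Submodule.Quotient.mk_add, chiI_mk Δ I x hx, chiI_mk Δ I x hx, chiI_mk Δ I x hx,
          ← Complex.exp_add, ← mul_add, ← Complex.ofReal_add, ← dotp_add_right]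
        congr 4; funext k; simp }
  have h := AddChar.sum_eq_ite ψ
  have hψ : ψ = 0 ↔ ∀ k, ∃ m : ℤ, x k = m := by
    constructor
    · intro h0 k
      have h1 : chiI Δ I x (Submodule.Quotient.mk (Pi.single k 1)) = 1 := by
        change ψ _ = 1
        rw [h0]; rfl
      rw [chiI_mk Δ I x hx, Complex.exp_eq_one_iff] at h1
      obtain ⟨m, hm⟩ := h1
      refine ⟨m, ?_⟩
      have h2 : dotp x (fun j => ((Pi.single k 1 : Fin n → ℤ) j : ℝ)) = x k := by
        rw [← dotp_single_right x k]; congr 1; funext j; simp [Pi.single_apply]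
      rw [h2, mul_comm] at hm
      have h3 := mul_right_cancel₀ Complex.two_pi_I_ne_zero hm
      exact_mod_cast h3
    · intro hk
      ext g
      induction g using Submodule.Quotient.induction_on with | _ g =>
      change chiI Δ I x _ = 1
      rw [chiI_mk Δ I x hx, Complex.exp_eq_one_iff]
      choose m hm using hk
      refine ⟨∑ k, m k * g k, ?_⟩
      unfold dotp; simp only [hm]; push_cast; ring
  rw [if_congr hψ rfl rfl] at h
  rw [Nat.card_eq_fintype_card]
  exact h

theorem chiI_sum (Δ : LMultiFan n d) (I : Finset (Fin d)) (uI : Fin d → Fin n → ℝ)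
    (m : {x // x ∈ I} → ℤ)
    (g : (Fin n → ℤ) ⧸ Submodule.span ℤ (Δ.v '' (I : Set (Fin d)))) :
    ∏ i : {x // x ∈ I}, ((chiI Δ I (uI i) g)⁻¹) ^ m i =
      chiI Δ I (-∑ i : {x // x ∈ I}, (m i : ℝ) • uI i) g := by
  simp only [chiI_eq]
  rw [dotp_comm, dotp_neg_right, dotp_sum_right]
  simp only [← Complex.exp_neg, ← Complex.exp_int_mul, ← Complex.exp_sum]
  congr 1
  push_cast
  rw [← Finset.sum_neg_distrib, Finset.mul_sum]
  refine Finset.sum_congr rfl fun i _ => ?_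
  rw [dotp_smul_right, dotp_comm]; push_cast; ring

end LMultiFan

open Finset
namespace LMultiFan
variable {n d : ℕ}

theorem hasSum_q (q : ℂ) (e : ℤ) (he : e ≠ 0) (hq0 : q ≠ 0) (h1 : 0 < e → ‖q‖ < 1)
    (h2 : e < 0 → 1 < ‖q‖) :
    HasSum (fun k : ℤ => if (0 < e ∧ 1 ≤ k) ∨ (e < 0 ∧ k ≤ 0) then q ^ k else 0)
      ((if 0 < e then -1 else 1) * (1 - q⁻¹)⁻¹) := by
  rcases lt_or_gt_of_ne he with h | h
  · have hn : ¬ (0 < e) := by omega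
    simpa [h, hn] using hasSum_geo_neg q (h2 h)
  · have hn : ¬ (e < 0) := by omega
    simpa [h, hn] using hasSum_geo_pos q (h1 h) hq0

open scoped Classical in
theorem prod_region (Δ : LMultiFan n d) (I : Finset (Fin d)) (uI : Fin d → Fin n → ℝ)
    (e : Fin d → ℤ) (z : ℂ) (hz : z ≠ 0) (m : {x // x ∈ I} → ℤ)
    (g : (Fin n → ℤ) ⧸ Submodule.span ℤ (Δ.v '' (I : Set (Fin d)))) :
    (∏ i : {x // x ∈ I}, (if (0 < e i ∧ 1 ≤ m i) ∨ (e i < 0 ∧ m i ≤ 0) then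
      ((chiI Δ I (uI i) g)⁻¹ * z ^ (e i)) ^ (m i) else 0)) =
    if (∀ i : {x // x ∈ I}, (0 < e i ∧ 1 ≤ m i) ∨ (e i < 0 ∧ m i ≤ 0)) then
      chiI Δ I (-∑ i : {x // x ∈ I}, (m i : ℝ) • uI i) g * z ^ (∑ i : {x // x ∈ I}, m i * e i)
      else 0 := by
  split_ifs with h
  · rw [← chiI_sum]
    have : z ^ (∑ i : {x // x ∈ I}, m i * e i) = ∏ i : {x // x ∈ I}, (z ^ (e i)) ^ (m i) := by
      have h1 : ∀ s : Finset {x // x ∈ I}, z ^ (∑ i ∈ s, m i * e i) = ∏ i ∈ s, (z ^ (e i)) ^ (m i) := by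
        intro s
        induction s using Finset.induction_on with
        | empty => simp
        | insert a s ha ih => rw [Finset.sum_insert ha, Finset.prod_insert ha, zpow_add₀ hz, ih,
            mul_comm (m a), zpow_mul]
      exact h1 _
    rw [this, ← Finset.prod_mul_distrib]
    refine Finset.prod_congr rfl fun i _ => ?_
    rw [if_pos (h i), mul_zpow]
  · push Not at h
    obtain ⟨i, hi⟩ := h
    refine Finset.prod_eq_zero (Finset.mem_univ i) ?_
    rw [if_neg]
    rintro (⟨h1, h2⟩ | ⟨h1, h2⟩)
    · exact absurd h2 (not_le.2 (hi.1 h1))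
    · exact absurd h2 (not_le.2 (hi.2 h1))

open scoped Classical in
theorem hasSum_I (Δ : LMultiFan n d)
    (c : Fin d → ℝ) (uu : Finset (Fin d) → Fin d → (Fin n → ℝ))
    (huu : Δ.toMF.DualBasis uu) (vv : Fin n → ℤ)
    (I : Finset (Fin d)) (hI : I ∈ Δ.S) (hc : I.card = n)
    (hlat : ∀ k : Fin n, ∃ m : ℤ, (∑ i ∈ I, c i * uu I i k) = (m : ℝ))
    (e : Fin d → ℤ)
    (he : ∀ i ∈ I, (e i : ℝ) = dotp (uu I i) (fun k => (vv k : ℝ)) ∧ e i ≠ 0)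
    (eV : ℤ)
    (heV : (eV : ℝ) = ∑ k, (∑ i ∈ I, c i * uu I i k) * (vv k : ℝ))
    (z : ℂ) (hz : z ≠ 0) (hz1 : ‖z‖ < 1) :
    HasSum (fun u : Fin n → ℤ => (((if (∀ i ∈ I,
          (0 < dotp (uu I i) (fun k => (vv k : ℝ)) ∧
            c i + 1/2 ≤ dotp (fun k => (u k : ℝ)) (Δ.toMF.v i)) ∨
          (dotp (uu I i) (fun k => (vv k : ℝ)) < 0 ∧
            dotp (fun k => (u k : ℝ)) (Δ.toMF.v i) ≤ c i + 1/2))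
        then (-1 : ℤ) ^ (I.filter fun i => 0 < dotp (uu I i) (fun k => (vv k : ℝ))).card * Δ.w I
        else 0 : ℤ)) : ℂ) * z ^ (∑ k, u k * vv k))
      (((Δ.w I : ℂ) * z ^ eV /
          (Nat.card ((Fin n → ℤ) ⧸ Submodule.span ℤ (Δ.v '' (I : Set (Fin d)))) : ℂ)) *
        ∑ᶠ g : (Fin n → ℤ) ⧸ Submodule.span ℤ (Δ.v '' (I : Set (Fin d))),
          (∏ i ∈ I, (1 - chiI Δ I (uu I i) g * z ^ (-(e i))))⁻¹) := by
  have hfin := Δ.finite_quot hI hc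
  let hft : Fintype ((Fin n → ℤ) ⧸ Submodule.span ℤ (Δ.v '' (I : Set (Fin d)))) := Fintype.ofFinite _
  have hcard : (Nat.card ((Fin n → ℤ) ⧸ Submodule.span ℤ (Δ.v '' (I : Set (Fin d)))) : ℂ) ≠ 0 := by
    exact Nat.cast_ne_zero.2 Nat.card_pos.ne'
  choose C hCc using hlat
  -- pairing of integral vectors
  have hpair : ∀ (u : Fin n → ℤ) (i : Fin d),
      dotp (fun k => (u k : ℝ)) (Δ.toMF.v i) = ((∑ k, u k * Δ.v i k : ℤ) : ℝ) := by
    intro u i; unfold dotp toMF; push_cast; rfl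
  have hcC : ∀ i ∈ I, c i = dotp (fun k => (C k : ℝ)) (Δ.toMF.v i) := by
    intro i hi
    have h1 : (fun k => (C k : ℝ)) = ∑ j ∈ I, c j • uu I j := by
      funext k; rw [← hCc]; simp
    rw [h1, dotp_comm, dotp_sum_right, Finset.sum_eq_single i]
    · rw [dotp_smul_right, dotp_comm, huu I hI hc i hi i hi]; simp
    · intro j hj hji
      rw [dotp_smul_right, dotp_comm, huu I hI hc j hj i hi, if_neg hji, mul_zero]
    · exact fun h => absurd hi h
  let Φ : (Fin n → ℤ) → ({x // x ∈ I} → ℤ) := fun u i => ∑ k, (u k - C k) * Δ.v i k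
  have hΦ : ∀ u (i : {x // x ∈ I}), dotp (fun k => (u k : ℝ)) (Δ.toMF.v i) = c i + (Φ u i : ℝ) := by
    intro u i
    rw [hcC i i.2, hpair, hpair]
    simp only [Φ, sub_mul, Finset.sum_sub_distrib]
    push_cast; ring
  have hΦsum : ∀ u k, ∑ i : {x // x ∈ I}, (Φ u i : ℝ) * uu I i k = (u k : ℝ) - C k := by
    intro u k
    have h1 := Δ.toMF.expand3 uu huu hI hc (fun k => (u k : ℝ)) k
    have h2 := Δ.toMF.expand3 uu huu hI hc (fun k => (C k : ℝ)) k
    rw [← Finset.sum_coe_sort] at h1 h2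
    rw [h1, h2, ← Finset.sum_sub_distrib]
    refine Finset.sum_congr rfl fun i _ => ?_
    rw [hΦ u i, ← hcC i i.2]; ring
  have hinj : Function.Injective Φ := by
    intro u u' h
    funext k
    have h1 := hΦsum u k
    have h2 := hΦsum u' k
    rw [h, h2] at h1
    have : (u' k : ℝ) = u k := by linarith
    exact_mod_cast this.symm
  have hrange : ∀ m : {x // x ∈ I} → ℤ, m ∈ Set.range Φ ↔
      ∀ k, ∃ r : ℤ, (-∑ i : {x // x ∈ I}, (m i : ℝ) • uu I i) k = r := by
    intro m
    constructor
    · rintro ⟨u, rfl⟩ k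
      refine ⟨-(u k - C k), ?_⟩
      push_cast; rw [← hΦsum]; simp
    · intro h
      choose r hr using h
      refine ⟨fun k => C k - r k, ?_⟩
      funext j
      have h3 : ((Φ (fun k => C k - r k) j : ℤ) : ℝ) = m j := by
        have h4 : (∑ i : {x // x ∈ I}, (m i : ℝ) • uu I i) = fun k => -(r k : ℝ) := by
          funext k; rw [← hr k]; simp
        have h5 : ((Φ (fun k => C k - r k) j : ℤ) : ℝ) = dotp (fun k => -(r k : ℝ)) (Δ.toMF.v j) := by
          simp only [Φ, dotp, toMF]; push_cast
          exact Finset.sum_congr rfl fun k _ => by ring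
        rw [h5, ← h4, dotp_comm, dotp_sum_right, Finset.sum_eq_single j]
        · rw [dotp_smul_right, dotp_comm, huu I hI hc j j.2 j j.2]; simp
        · intro b _ hb
          rw [dotp_smul_right, dotp_comm, huu I hI hc b b.2 j j.2, if_neg, mul_zero]
          exact fun h => hb (Subtype.ext h)
        · simp
      exact_mod_cast h3
  have hpairm : ∀ m : {x // x ∈ I} → ℤ, ∀ i ∈ I, ∃ r : ℤ,
      dotp (-∑ i : {x // x ∈ I}, (m i : ℝ) • uu I i) (fun k => (Δ.v i k : ℝ)) = r := by
    intro m j hj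
    refine ⟨-m ⟨j, hj⟩, ?_⟩
    change dotp _ (Δ.toMF.v j) = _
    rw [dotp_comm, dotp_neg_right, dotp_sum_right, Finset.sum_eq_single ⟨j, hj⟩]
    · rw [dotp_smul_right, dotp_comm, huu I hI hc j hj j hj]; simp
    · intro b _ hb
      rw [dotp_smul_right, dotp_comm, huu I hI hc b b.2 j hj, if_neg, mul_zero]
      exact fun h => hb (Subtype.ext h)
    · simp
  have hexp : ∀ u, ∑ k, u k * vv k = eV + ∑ i : {x // x ∈ I}, Φ u i * e i := by
    intro u
    have h1 := Δ.toMF.expand2 uu huu hI hc (fun k => (u k : ℝ)) (fun k => (vv k : ℝ))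
    have h2 := Δ.toMF.expand2 uu huu hI hc (fun k => (C k : ℝ)) (fun k => (vv k : ℝ))
    rw [← Finset.sum_coe_sort] at h1 h2
    have h3 : (eV : ℝ) = dotp (fun k => (C k : ℝ)) (fun k => (vv k : ℝ)) := by
      rw [heV]; unfold dotp; exact Finset.sum_congr rfl fun k _ => by rw [hCc]
    have h4 : ((∑ k, u k * vv k : ℤ) : ℝ) = ((eV + ∑ i : {x // x ∈ I}, Φ u i * e i : ℤ) : ℝ) := by
      push_cast
      rw [h3]
      change dotp (fun k => (u k : ℝ)) (fun k => (vv k : ℝ)) = _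
      rw [h1, h2, ← Finset.sum_add_distrib]
      refine Finset.sum_congr rfl fun i _ => ?_
      rw [hΦ u i, ← hcC i i.2, (he i i.2).1]; ring
    exact_mod_cast h4
  -- the sum over all of `ℤ^I`
  have hq : ∀ (g : (Fin n → ℤ) ⧸ Submodule.span ℤ (Δ.v '' (I : Set (Fin d)))) (i : {x // x ∈ I}),
      HasSum (fun k : ℤ => if (0 < e i ∧ 1 ≤ k) ∨ (e i < 0 ∧ k ≤ 0) then
        ((chiI Δ I (uu I i) g)⁻¹ * z ^ (e i)) ^ k else 0)
      ((if 0 < e i then -1 else 1) * (1 - chiI Δ I (uu I i) g * z ^ (-(e i)))⁻¹) := by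
    intro g i
    have hchi := norm_chiI Δ I (uu I i) g
    have hchi0 : chiI Δ I (uu I i) g ≠ 0 := by
      intro h; rw [h] at hchi; simp at hchi
    have hn : ‖(chiI Δ I (uu I i) g)⁻¹ * z ^ (e i)‖ = ‖z ^ (e i)‖ := by
      rw [norm_mul, norm_inv, hchi]; simp
    have := hasSum_q ((chiI Δ I (uu I i) g)⁻¹ * z ^ (e i)) (e i) (he i i.2).2
      (mul_ne_zero (inv_ne_zero hchi0) (zpow_ne_zero _ hz))
      (fun h => by rw [hn]; exact norm_zpow_lt z hz hz1 _ h)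
      (fun h => by rw [hn]; exact norm_zpow_gt z hz hz1 _ h)
    rwa [mul_inv, inv_inv, ← zpow_neg] at this
  have hpi := fun g => hasSum_pi_prod _ _ (hq g)
  have hsum := (hasSum_sum (s := Finset.univ) (fun g _ => hpi g)).mul_left
    (((-1 : ℂ) ^ (I.filter fun i => 0 < dotp (uu I i) (fun k => (vv k : ℝ))).card * Δ.w I) * z ^ eV /
      (Nat.card ((Fin n → ℤ) ⧸ Submodule.span ℤ (Δ.v '' (I : Set (Fin d)))) : ℂ))
  have hval : ∀ m : {x // x ∈ I} → ℤ, ∑ g, (∏ i : {x // x ∈ I}, 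
      (if (0 < e i ∧ 1 ≤ m i) ∨ (e i < 0 ∧ m i ≤ 0) then
      ((chiI Δ I (uu I i) g)⁻¹ * z ^ (e i)) ^ (m i) else 0)) =
      if (∀ i : {x // x ∈ I}, (0 < e i ∧ 1 ≤ m i) ∨ (e i < 0 ∧ m i ≤ 0)) ∧ m ∈ Set.range Φ then
      (Nat.card ((Fin n → ℤ) ⧸ Submodule.span ℤ (Δ.v '' (I : Set (Fin d)))) : ℂ) *
        z ^ (∑ i : {x // x ∈ I}, m i * e i) else 0 := by
    intro m
    rw [Finset.sum_congr rfl fun g _ => prod_region Δ I (uu I) e z hz m g]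
    by_cases hreg : (∀ i : {x // x ∈ I}, (0 < e i ∧ 1 ≤ m i) ∨ (e i < 0 ∧ m i ≤ 0))
    · simp only [if_pos hreg]
      rw [← Finset.sum_mul, orth Δ I _ (hpairm m)]
      by_cases hr : m ∈ Set.range Φ
      · rw [if_pos ((hrange m).1 hr), if_pos ⟨hreg, hr⟩]
      · rw [if_neg (fun h => hr ((hrange m).2 h)), if_neg (fun h => hr h.2), zero_mul]
    · simp only [if_neg hreg]
      rw [if_neg (fun h => hreg h.1)]; simp
  rw [← hinj.hasSum_iff] at hsum
  · refine hs_congr hsum (fun u => ?_) ?_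
    · simp only [Function.comp]
      rw [hval, hexp u]
      have hcond : (∀ i ∈ I,
          (0 < dotp (uu I i) (fun k => (vv k : ℝ)) ∧
            c i + 1/2 ≤ dotp (fun k => (u k : ℝ)) (Δ.toMF.v i)) ∨
          (dotp (uu I i) (fun k => (vv k : ℝ)) < 0 ∧
            dotp (fun k => (u k : ℝ)) (Δ.toMF.v i) ≤ c i + 1/2)) ↔
          ((∀ i : {x // x ∈ I}, (0 < e i ∧ 1 ≤ Φ u i) ∨ (e i < 0 ∧ Φ u i ≤ 0)) ∧ Φ u ∈ Set.range Φ) := by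
        have hr : Φ u ∈ Set.range Φ := ⟨u, rfl⟩
        simp only [hr, and_true]
        rw [Subtype.forall]
        refine forall₂_congr fun i hi => ?_
        rw [← (he i hi).1, hΦ u ⟨i, hi⟩]
        have hA : (0 < (e i : ℝ)) ↔ 0 < e i := by exact_mod_cast Iff.rfl
        have hB : ((e i : ℝ) < 0) ↔ e i < 0 := by exact_mod_cast Iff.rfl
        have hP : (c i + 1/2 ≤ c i + (Φ u ⟨i, hi⟩ : ℝ)) ↔ 1 ≤ Φ u ⟨i, hi⟩ := by
          constructor
          · intro h
            have h' : (0 : ℝ) < (Φ u ⟨i, hi⟩ : ℝ) := by linarith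
            have h'' : 0 < Φ u ⟨i, hi⟩ := by exact_mod_cast h'
            omega
          · intro h
            have h' : (1 : ℝ) ≤ (Φ u ⟨i, hi⟩ : ℝ) := by exact_mod_cast h
            linarith
        have hN : (c i + (Φ u ⟨i, hi⟩ : ℝ) ≤ c i + 1/2) ↔ Φ u ⟨i, hi⟩ ≤ 0 := by
          constructor
          · intro h
            have h' : (Φ u ⟨i, hi⟩ : ℝ) < 1 := by linarith
            have h'' : Φ u ⟨i, hi⟩ < 1 := by exact_mod_cast h'
            omega
          · intro h
            have h' : (Φ u ⟨i, hi⟩ : ℝ) ≤ 0 := by exact_mod_cast h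
            linarith
        rw [hA, hB, hP, hN]
      by_cases hh : ((∀ i : {x // x ∈ I}, (0 < e i ∧ 1 ≤ Φ u i) ∨ (e i < 0 ∧ Φ u i ≤ 0)) ∧ Φ u ∈ Set.range Φ)
      · rw [if_pos (hcond.2 hh), if_pos hh, zpow_add₀ hz]
        push_cast
        field_simp
      · rw [if_neg (fun h => hh (hcond.1 h)), if_neg hh]; simp
    · rw [finsum_eq_sum_of_fintype]
      have hsg : (∏ i : {x // x ∈ I}, (if 0 < e i then (-1 : ℂ) else 1)) =
          (-1 : ℂ) ^ (I.filter fun i => 0 < dotp (uu I i) (fun k => (vv k : ℝ))).card := by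
        rw [← Finset.prod_const, Finset.prod_filter, 
          Finset.prod_coe_sort I (fun i => if 0 < e i then (-1 : ℂ) else 1)]
        refine Finset.prod_congr rfl fun i hi => ?_
        rw [← (he i hi).1]
        simp only [Int.cast_pos]
      have h1 : ∀ g : (Fin n → ℤ) ⧸ Submodule.span ℤ (Δ.v '' (I : Set (Fin d))),
          (∏ i : {x // x ∈ I}, ((if 0 < e i then -1 else 1) * (1 - chiI Δ I (uu I i) g * z ^ (-(e i)))⁻¹)) =
          (-1 : ℂ) ^ (I.filter fun i => 0 < dotp (uu I i) (fun k => (vv k : ℝ))).card *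
          (∏ i ∈ I, (1 - chiI Δ I (uu I i) g * z ^ (-(e i))))⁻¹ := by
        intro g
        rw [Finset.prod_mul_distrib, hsg, ← Finset.prod_inv_distrib, 
          ← Finset.prod_coe_sort I (fun i => (1 - chiI Δ I (uu I i) g * z ^ (-(e i)))⁻¹)]
      simp only [h1]
      rw [← Finset.mul_sum]
      have h2 : (-1 : ℂ) ^ (I.filter fun i => 0 < dotp (uu I i) (fun k => (vv k : ℝ))).card *
        (-1 : ℂ) ^ (I.filter fun i => 0 < dotp (uu I i) (fun k => (vv k : ℝ))).card = 1 := by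
        rw [← mul_pow]; simp
      generalize (-1 : ℂ) ^ (I.filter fun i => 0 < dotp (uu I i) (fun k => (vv k : ℝ))).card = σ at h2
      generalize (∑ g : (Fin n → ℤ) ⧸ Submodule.span ℤ (Δ.v '' (I : Set (Fin d))),
          (∏ i ∈ I, (1 - chiI Δ I (uu I i) g * z ^ (-(e i))))⁻¹) = X
      simp only [div_eq_mul_inv]
      linear_combination (-(Δ.w I : ℂ) * z ^ eV * (Nat.card ((Fin n → ℤ) ⧸ Submodule.span ℤ (Δ.v '' (I : Set (Fin d)))) : ℂ)⁻¹ * X) * h2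
  · intro m hm
    rw [hval, if_neg (fun h => hm h.2), mul_zero]

end LMultiFan

open Finset

theorem finite_zpow_eq (e : ℤ) (he : e ≠ 0) (a : ℂ) : {z : ℂ | z ^ e = a}.Finite := by
  have hnat : ∀ (m : ℕ) (b : ℂ), 0 < m → {z : ℂ | z ^ m = b}.Finite := by
    intro m b hm
    refine ((Polynomial.nthRoots m b).toFinset.finite_toSet).subset ?_
    intro z hz
    simp only [Finset.mem_coe, Multiset.mem_toFinset]
    exact (Polynomial.mem_nthRoots hm).2 hz
  rcases lt_or_gt_of_ne he with h | h
  · refine (hnat (-e).toNat a⁻¹ (by omega)).subset ?_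
    intro z hz
    simp only [Set.mem_setOf_eq] at hz ⊢
    rw [← zpow_natCast, Int.toNat_of_nonneg (by omega), zpow_neg, hz]
  · refine (hnat e.toNat a (by omega)).subset ?_
    intro z hz
    simp only [Set.mem_setOf_eq] at hz ⊢
    rw [← zpow_natCast, Int.toNat_of_nonneg (by omega), hz]

namespace LMultiFan
variable {n d : ℕ}

theorem off_hyper (Δ : LMultiFan n d) (c : Fin d → ℝ)
    (uu : Finset (Fin d) → Fin d → (Fin n → ℝ)) (huu : Δ.toMF.DualBasis uu)
    (hlat : Δ.LatticeVertices c uu) (u : Fin n → ℤ) (I : Finset (Fin d)) (hI : I ∈ Δ.S)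
    (hc : I.card = n) (i : Fin d) (hi : i ∈ I) :
    dotp (fun k => (u k : ℝ)) (Δ.toMF.v i) - (c i + 1/2) ≠ 0 := by
  choose C hCc using hlat I hI hc
  have hpair : ∀ (u : Fin n → ℤ) (i : Fin d),
      dotp (fun k => (u k : ℝ)) (Δ.toMF.v i) = ((∑ k, u k * Δ.v i k : ℤ) : ℝ) := by
    intro u i; unfold dotp toMF; push_cast; rfl
  have hcC : c i = dotp (fun k => (C k : ℝ)) (Δ.toMF.v i) := by
    have h1 : (fun k => (C k : ℝ)) = ∑ j ∈ I, c j • uu I j := by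
      funext k; rw [← hCc]; simp
    rw [h1, dotp_comm, dotp_sum_right, Finset.sum_eq_single i]
    · rw [dotp_smul_right, dotp_comm, huu I hI hc i hi i hi]; simp
    · intro j hj hji
      rw [dotp_smul_right, dotp_comm, huu I hI hc j hj i hi, if_neg hji, mul_zero]
    · exact fun h => absurd hi h
  rw [hcC, hpair, hpair]
  generalize (∑ k, u k * Δ.v i k : ℤ) = a
  generalize (∑ k, C k * Δ.v i k : ℤ) = b
  intro h
  have h2 : ((2 * a : ℤ) : ℝ) = ((2 * b + 1 : ℤ) : ℝ) := by push_cast; linarith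
  have h3 : 2 * a = 2 * b + 1 := by exact_mod_cast h2
  omega

/-- the denominators do not vanish in the punctured unit disc -/
theorem no_pole (Δ : LMultiFan n d) (I : Finset (Fin d)) (x : Fin n → ℝ)
    (g : (Fin n → ℤ) ⧸ Submodule.span ℤ (Δ.v '' (I : Set (Fin d)))) (e : ℤ) (he : e ≠ 0)
    (z : ℂ) (hz : z ≠ 0) (hz1 : ‖z‖ < 1) : 1 - chiI Δ I x g * z ^ (-e) ≠ 0 := by
  intro h
  have h1 : ‖chiI Δ I x g * z ^ (-e)‖ = 1 := by
    rw [← sub_eq_zero.1 h, norm_one]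
  rw [norm_mul, norm_chiI, one_mul] at h1
  rcases lt_or_gt_of_ne he with h2 | h2
  · exact absurd h1 (norm_zpow_lt z hz hz1 (-e) (by omega)).ne
  · exact absurd h1 (norm_zpow_gt z hz hz1 (-e) (by omega)).ne'

end LMultiFan


/-- **Lemma 7.3** (generating function identity): for a simple lattice multi-polytope `P`
and `v ∈ N` with all `⟨u_i^I, v⟩` nonzero integers (`e I i = ⟨u_i^I, v⟩`,
`eV I = ⟨u_I, v⟩`),
`∑_{I∈Σ^{(n)}} (w(I) z^{⟨u_I,v⟩}/|N/N_I|) ∑_{g∈N/N_I} 1/∏_{i∈I}(1 − χ_I(u_i^I,g) z^{−⟨u_i^I,v⟩})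
  = ∑_{u∈N^*} DH_{P_+}(u) z^{⟨u,v⟩}`
as functions of `z ∈ ℂ` (away from zeros of the denominators). -/
theorem stmt12 (n d : ℕ) (Δ : LMultiFan n d) (hC : Δ.toMF.Complete)
    (c : Fin d → ℝ) (uu : Finset (Fin d) → Fin d → (Fin n → ℝ))
    (huu : Δ.toMF.DualBasis uu) (ξ : Fin n → ℝ) (hξ : Δ.toMF.GenericDual uu ξ)
    (hlat : Δ.LatticeVertices c uu)
    (vv : Fin n → ℤ)
    (e : Finset (Fin d) → Fin d → ℤ)
    (he : ∀ I ∈ Δ.S, I.card = n → ∀ i ∈ I,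
      (e I i : ℝ) = dotp (uu I i) (fun k => (vv k : ℝ)) ∧ e I i ≠ 0)
    (eV : Finset (Fin d) → ℤ)
    (heV : ∀ I ∈ Δ.S, I.card = n →
      (eV I : ℝ) = ∑ k, (∑ i ∈ I, c i * uu I i k) * (vv k : ℝ))
    (z : ℂ) (hz : z ≠ 0)
    (hpole : ∀ I ∈ Δ.S, I.card = n → ∀ i ∈ I,
      ∀ g : (Fin n → ℤ) ⧸ Submodule.span ℤ (Δ.v '' (I : Set (Fin d))),
        1 - chiI Δ I (uu I i) g * z ^ (-(e I i)) ≠ 0) :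
    ∑ I ∈ Δ.S.filter (fun I => I.card = n),
      ((Δ.w I : ℂ) * z ^ (eV I) /
          (Nat.card ((Fin n → ℤ) ⧸ Submodule.span ℤ (Δ.v '' (I : Set (Fin d)))) : ℂ)) *
        ∑ᶠ g : (Fin n → ℤ) ⧸ Submodule.span ℤ (Δ.v '' (I : Set (Fin d))),
          (∏ i ∈ I, (1 - chiI Δ I (uu I i) g * z ^ (-(e I i))))⁻¹
    = ∑ᶠ u : Fin n → ℤ,
        (Δ.toMF.DH (fun i => c i + 1/2) uu ξ (fun k => (u k : ℝ)) : ℂ) *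
          z ^ (∑ k, u k * vv k) := by
  classical
  have hoff := Δ.off_hyper c uu huu hlat
  have hvv : Δ.toMF.GenericDual uu (fun k => (vv k : ℝ)) := by
    intro I hI hc i hi h
    have h1 := he I hI hc i hi
    rw [h] at h1
    exact h1.2 (by exact_mod_cast h1.1)
  have hfin := Δ.toMF.DH_finite hC (fun i => c i + 1/2) uu huu ξ hξ hoff
  have hR : ∀ z : ℂ, (∑ᶠ u : Fin n → ℤ,
        (Δ.toMF.DH (fun i => c i + 1/2) uu ξ (fun k => (u k : ℝ)) : ℂ) *
          z ^ (∑ k, u k * vv k)) = ∑ u ∈ hfin.toFinset,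
        (Δ.toMF.DH (fun i => c i + 1/2) uu ξ (fun k => (u k : ℝ)) : ℂ) *
          z ^ (∑ k, u k * vv k) := by
    intro z
    apply finsum_eq_sum_of_support_subset
    intro u hu
    simp only [Set.Finite.coe_toFinset, Set.mem_setOf_eq]
    intro h
    rw [Function.mem_support, h] at hu
    simp at hu
  set L : ℂ → ℂ := fun z => ∑ I ∈ Δ.S.filter (fun I => I.card = n),
      ((Δ.w I : ℂ) * z ^ (eV I) /
          (Nat.card ((Fin n → ℤ) ⧸ Submodule.span ℤ (Δ.v '' (I : Set (Fin d)))) : ℂ)) *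
        ∑ᶠ g : (Fin n → ℤ) ⧸ Submodule.span ℤ (Δ.v '' (I : Set (Fin d))),
          (∏ i ∈ I, (1 - chiI Δ I (uu I i) g * z ^ (-(e I i))))⁻¹ with hL
  set R : ℂ → ℂ := fun z => ∑ u ∈ hfin.toFinset,
        (Δ.toMF.DH (fun i => c i + 1/2) uu ξ (fun k => (u k : ℝ)) : ℂ) *
          z ^ (∑ k, u k * vv k) with hRdef
  have key : ∀ z : ℂ, z ≠ 0 → ‖z‖ < 1 → L z = R z := by
    intro z hz hz1
    have h1 : HasSum (fun u : Fin n → ℤ =>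
        (Δ.toMF.DH (fun i => c i + 1/2) uu ξ (fun k => (u k : ℝ)) : ℂ) *
          z ^ (∑ k, u k * vv k)) (L z) := by
      have h2 := hasSum_sum (s := Δ.S.filter (fun I => I.card = n)) (fun I hI =>
        Δ.hasSum_I c uu huu vv I (Finset.mem_filter.1 hI).1 (Finset.mem_filter.1 hI).2
          (hlat I (Finset.mem_filter.1 hI).1 (Finset.mem_filter.1 hI).2) (e I)
          (he I (Finset.mem_filter.1 hI).1 (Finset.mem_filter.1 hI).2) (eV I)
          (heV I (Finset.mem_filter.1 hI).1 (Finset.mem_filter.1 hI).2) z hz hz1)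
      refine hs_congr h2 (fun u => ?_) rfl
      rw [Δ.toMF.DH_const hC (fun i => c i + 1/2) uu huu ξ (fun k => (vv k : ℝ)) _ (hoff u) hξ hvv,
        ← Finset.sum_mul, ← Int.cast_sum]
      rfl
    have h3 : HasSum (fun u : Fin n → ℤ =>
        (Δ.toMF.DH (fun i => c i + 1/2) uu ξ (fun k => (u k : ℝ)) : ℂ) *
          z ^ (∑ k, u k * vv k)) (R z) := by
      apply hasSum_sum_of_ne_finset_zero
      intro u hu
      have : Δ.toMF.DH (fun i => c i + 1/2) uu ξ (fun k => (u k : ℝ)) = 0 := by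
        by_contra h
        exact hu (by simpa using h)
      rw [this]; simp
    exact h1.unique h3
  rw [hR z]
  change L z = R z
  let U : Set ℂ := {z | z ≠ 0 ∧ ∀ I ∈ Δ.S, I.card = n → ∀ i ∈ I,
      ∀ g : (Fin n → ℤ) ⧸ Submodule.span ℤ (Δ.v '' (I : Set (Fin d))),
        1 - chiI Δ I (uu I i) g * z ^ (-(e I i)) ≠ 0}
  have hUc : Uᶜ.Finite := by
    let T : Finset (Fin d) → Set ℂ := fun I => ⋃ i ∈ I,
      ⋃ g : (Fin n → ℤ) ⧸ Submodule.span ℤ (Δ.v '' (I : Set (Fin d))),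
        {z : ℂ | z ^ (e I i) = chiI Δ I (uu I i) g}
    have hT : (({0} : Set ℂ) ∪ ⋃ I ∈ Δ.S.filter (fun I => I.card = n), T I).Finite := by
      refine (Set.finite_singleton 0).union ?_
      refine (Finset.finite_toSet _).biUnion fun I hI => ?_
      obtain ⟨hI, hc⟩ := Finset.mem_filter.1 (Finset.mem_coe.1 hI)
      refine (Finset.finite_toSet _).biUnion fun i hi => ?_
      have := Δ.finite_quot hI hc
      exact Set.finite_iUnion fun g => finite_zpow_eq _ (he I hI hc i hi).2 _
    refine hT.subset ?_
    intro y hy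
    by_cases hy0 : y = 0
    · exact Or.inl hy0
    refine Or.inr ?_
    by_contra hcon
    apply hy
    refine ⟨hy0, fun I hI hc i hi g h => hcon ?_⟩
    simp only [Set.mem_iUnion, T]
    refine ⟨I, Finset.mem_filter.2 ⟨hI, hc⟩, i, hi, g, ?_⟩
    have h1 := sub_eq_zero.1 h
    rw [zpow_neg] at h1
    have h2 : y ^ (e I i) ≠ 0 := zpow_ne_zero _ hy0
    change y ^ (e I i) = _
    field_simp at h1
    exact h1
  have hUo : IsOpen U := by
    rw [← isClosed_compl_iff]; exact hUc.isClosed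
  have hUpc : IsPreconnected U := by
    have := hUc.countable.isPathConnected_compl_of_one_lt_rank (E := ℂ)
      (by rw [Complex.rank_real_complex]; exact Nat.one_lt_ofNat)
    rw [compl_compl] at this
    exact this.isConnected.isPreconnected
  have hzp : ∀ y : ℂ, y ≠ 0 → ∀ m : ℤ, DifferentiableAt ℂ (fun z : ℂ => z ^ m) y :=
    fun y hy m => differentiableAt_zpow.2 (Or.inl hy)
  have hLd : AnalyticOnNhd ℂ L U := by
    refine DifferentiableOn.analyticOnNhd (fun y hy => DifferentiableAt.differentiableWithinAt ?_) hUo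
    rw [hL]
    refine DifferentiableAt.fun_sum fun I hI => ?_
    obtain ⟨hI, hc⟩ := Finset.mem_filter.1 hI
    have := Δ.finite_quot hI hc
    let hft : Fintype ((Fin n → ℤ) ⧸ Submodule.span ℤ (Δ.v '' (I : Set (Fin d)))) :=
      Fintype.ofFinite _
    simp only [finsum_eq_sum_of_fintype]
    refine DifferentiableAt.mul ?_ ?_
    · exact ((hzp y hy.1 _).const_mul _).div_const _
    · refine DifferentiableAt.fun_sum fun g _ => ?_
      refine DifferentiableAt.fun_inv ?_ ?_
      · refine DifferentiableAt.fun_finset_prod fun i _ => ?_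
        exact ((hzp y hy.1 _).const_mul _).const_sub _
      · exact Finset.prod_ne_zero_iff.2 fun i hi => hy.2 I hI hc i hi g
  have hRd : AnalyticOnNhd ℂ R U := by
    refine DifferentiableOn.analyticOnNhd (fun y hy => DifferentiableAt.differentiableWithinAt ?_) hUo
    rw [hRdef]
    exact DifferentiableAt.fun_sum fun u _ => (hzp y hy.1 _).const_mul _
  have hsub : ∀ y : ℂ, y ≠ 0 → ‖y‖ < 1 → y ∈ U := fun y hy hy1 =>
    ⟨hy, fun I hI hc i hi g => Δ.no_pole I (uu I i) g (e I i) (he I hI hc i hi).2 y hy hy1⟩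
  have hhalf : (1/2 : ℂ) ≠ 0 ∧ ‖(1/2 : ℂ)‖ < 1 := by
    constructor <;> norm_num
  refine AnalyticOnNhd.eqOn_of_preconnected_of_eventuallyEq hLd hRd hUpc
    (hsub (1/2) hhalf.1 hhalf.2) ?_ (show z ∈ U from ⟨hz, hpole⟩)
  have ho : IsOpen {y : ℂ | y ≠ 0 ∧ ‖y‖ < 1} :=
    isOpen_ne.inter (isOpen_lt continuous_norm continuous_const)
  filter_upwards [ho.mem_nhds hhalf] with y hy
  exact key y hy.1 hy.2
end

section
/- (Index map lands in polynomials) Let Δ be a complete simplicial multi-fan of dimension n in N, and define π_!: H_T*(Δ)⊗ℚ → S^{−1}H*(BT;ℚ) by π_!(x) = Σ_{I∈Σ^{(n)}} w(I) ι_I*(x) / (|N/N_I| ∏_{i∈I} u_i^I), where S is the set of nonzero positive-degree homogeneous elements of H*(BT;ℚ). Then the image of π_! lies in H*(BT;ℚ); in particular π_!(x_J) = w(J)/|N/N_J| for J∈Σ^{(n)}, and π_!(x_J) = 0 for J∈Σ with |J| < n. -/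
open Finset

/-- `π^* : H^*(BT;ℚ) → ℚ[x_1,…,x_d]` (before passing to the face ring), determined by
`π^*(u) = ∑_i ⟨u, v_i⟩ x_i` on `H^2(BT;ℚ)`. -/
noncomputable def piStar {n d : ℕ} (Δ : LMultiFan n d) :
    MvPolynomial (Fin n) ℚ →ₐ[ℚ] MvPolynomial (Fin d) ℚ :=
  MvPolynomial.aeval (fun k => ∑ i : Fin d, (Δ.v i k : ℚ) • MvPolynomial.X i)

/-- The ideal `(x_I : I ∉ Σ)` of the face ring, so that
`H_T^*(Δ) ⊗ ℚ = ℚ[x_1,…,x_d]/faceIdeal`. -/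
noncomputable def faceIdeal {n d : ℕ} (Δ : LMultiFan n d) : Ideal (MvPolynomial (Fin d) ℚ) :=
  Ideal.span { q : MvPolynomial (Fin d) ℚ |
    ∃ I : Finset (Fin d), I ∉ Δ.S ∧ q = ∏ i ∈ I, MvPolynomial.X i }

open scoped Classical in
/-- The restriction `ι_I^* : H_T^*(Δ)⊗ℚ → H^*(BT;ℚ)` (at the level of polynomial rings):
`x_i ↦ u_i^I` for `i ∈ I` and `x_i ↦ 0` otherwise. -/
noncomputable def iotaStar {n d : ℕ} (uu : Finset (Fin d) → Fin d → (Fin n → ℚ))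
    (I : Finset (Fin d)) : MvPolynomial (Fin d) ℚ →ₐ[ℚ] MvPolynomial (Fin n) ℚ :=
  MvPolynomial.aeval
    (fun i => if i ∈ I then ∑ k : Fin n, uu I i k • MvPolynomial.X k else 0)

/-- `uu I i = u_i^I` is the (rational) dual basis of `{v i : i ∈ I}`. -/
def DualBasisQ {n d : ℕ} (Δ : LMultiFan n d)
    (uu : Finset (Fin d) → Fin d → (Fin n → ℚ)) : Prop :=
  ∀ I ∈ Δ.S, I.card = n → ∀ i ∈ I, ∀ j ∈ I,
    (∑ k, uu I i k * (Δ.v j k : ℚ)) = if i = j then 1 else 0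

open scoped Classical in
/-- The index map (Gysin map) `π_! : H_T^*(Δ)⊗ℚ → S⁻¹H^*(BT;ℚ)`,
`π_!(x) = ∑_{I∈Σ^{(n)}} w(I) ι_I^*(x) / (|N/N_I| ∏_{i∈I} u_i^I)`. -/
noncomputable def piShriek {n d : ℕ} (Δ : LMultiFan n d)
    (uu : Finset (Fin d) → Fin d → (Fin n → ℚ)) (x : MvPolynomial (Fin d) ℚ) :
    FractionRing (MvPolynomial (Fin n) ℚ) :=
  ∑ I ∈ Δ.S.filter (fun I => I.card = n),
    algebraMap (MvPolynomial (Fin n) ℚ) (FractionRing (MvPolynomial (Fin n) ℚ))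
      (MvPolynomial.C ((Δ.w I : ℚ) /
        (Nat.card ((Fin n → ℤ) ⧸ Submodule.span ℤ (Δ.v '' (I : Set (Fin d)))) : ℚ))) *
    (algebraMap (MvPolynomial (Fin n) ℚ) _ (iotaStar uu I x) /
     algebraMap (MvPolynomial (Fin n) ℚ) _
       (∏ i ∈ I, ∑ k : Fin n, uu I i k • MvPolynomial.X k))

theorem aux_card {n : ℕ} (f : Fin n → Fin n → ℤ) (hf : LinearIndependent ℤ f) :
    Nat.card ((Fin n → ℤ) ⧸ Submodule.span ℤ (Set.range f)) = (Matrix.of f).det.natAbs := by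
  have h := Submodule.natAbs_det_basis_change (Pi.basisFun ℤ (Fin n))
    (Submodule.span ℤ (Set.range f)) (Module.Basis.span hf)
  rw [Pi.basisFun_det_apply] at h
  rw [← h]
  congr 2
  ext i j
  simp [Module.Basis.span_apply]

/-- The covector given by the minors of the matrix of `{v j : j ∈ K}`. -/
theorem aux_covector {n d : ℕ} (Δ : LMultiFan n d) (K : Finset (Fin d)) (hK : K.card + 1 = n) :
    ∃ u : Fin n → ℤ, (∀ j ∈ K, ∑ k, u k * Δ.v j k = 0) ∧
      ∀ i, i ∉ K → insert i K ∈ Δ.S →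
        (Nat.card ((Fin n → ℤ) ⧸
          Submodule.span ℤ (Δ.v '' ((insert i K : Finset (Fin d)) : Set (Fin d)))) =
            (∑ k, u k * Δ.v i k).natAbs ∧ ∑ k, u k * Δ.v i k ≠ 0) := by
  subst hK
  let e : Fin K.card ≃ K := K.equivFin.symm
  let M : (Fin (K.card + 1) → ℤ) → Matrix (Fin (K.card + 1)) (Fin (K.card + 1)) ℤ :=
    fun y => Matrix.of (Fin.cons y (fun j => Δ.v (e j)))
  let u : Fin (K.card + 1) → ℤ := fun k => (M 0).adjugate k 0
  have hdet : ∀ y, (M y).det = ∑ k, u k * y k := by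
    intro y
    rw [Matrix.det_eq_sum_mul_adjugate_row _ 0]
    refine Finset.sum_congr rfl fun k _ => ?_
    rw [mul_comm]
    have h1 : M y 0 k = y k := rfl
    have h2 : (M y).adjugate k 0 = u k := by
      simp only [u, Matrix.adjugate_apply]
      congr 1
      ext a b
      refine Fin.cases ?_ (fun a => ?_) a
      · simp
      · simp [M, Matrix.updateRow_apply, Fin.succ_ne_zero]
    rw [h1, h2]
  refine ⟨u, ?_, ?_⟩
  · intro j hj
    rw [← hdet]
    refine Matrix.det_zero_of_row_eq (i := 0) (j := Fin.succ (e.symm ⟨j, hj⟩))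
      (Fin.succ_ne_zero _).symm ?_
    ext k
    simp [M]
  · intro i hi hS
    rw [← hdet]
    let f : Fin (K.card + 1) → {x // x ∈ insert i K} :=
      Fin.cons ⟨i, Finset.mem_insert_self _ _⟩
        (fun j => ⟨e j, Finset.mem_insert_of_mem (e j).2⟩)
    have hf : Function.Injective f := by
      refine Fin.cons_injective_iff.2 ⟨?_, ?_⟩
      · rintro ⟨j, hj⟩
        have : (e j : Fin d) = i := congrArg Subtype.val hj
        exact hi (this ▸ (e j).2)
      · intro a b hab
        have : (e a : Fin d) = e b := by simpa using hab
        exact e.injective (Subtype.ext this)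
    have hMf : ∀ a k, M (Δ.v i) a k = Δ.v (f a) k := by
      intro a k
      refine Fin.cases ?_ (fun a => ?_) a
      · rfl
      · rfl
    have hli : LinearIndependent ℝ (fun a => fun k => ((M (Δ.v i) a k : ℤ) : ℝ)) := by
      have := (Δ.indep _ hS).comp f hf
      convert this using 1
      ext a k
      simp [hMf]
    have hne : (M (Δ.v i)).det ≠ 0 := by
      have h2 : ((M (Δ.v i)).map (Int.castRingHom ℝ)).det ≠ 0 := by
        have := (Matrix.linearIndependent_rows_iff_isUnit
          (A := (M (Δ.v i)).map (Int.castRingHom ℝ))).1 hli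
        exact ((Matrix.isUnit_iff_isUnit_det _).1 this).ne_zero
      intro h0
      apply h2
      rw [← RingHom.mapMatrix_apply, ← RingHom.map_det, h0, map_zero]
    refine ⟨?_, hne⟩
    have hliZ : LinearIndependent ℤ (fun a => M (Δ.v i) a) :=
      Matrix.linearIndependent_rows_of_det_ne_zero hne
    have := aux_card _ hliZ
    have hr : Set.range (fun a => M (Δ.v i) a)
        = Δ.v '' ((insert i K : Finset (Fin d)) : Set (Fin d)) := by
      ext y
      constructor
      · rintro ⟨a, rfl⟩
        exact ⟨f a, (f a).2, by ext k; exact (hMf a k).symm⟩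
      · rintro ⟨j, hj, rfl⟩
        rcases Finset.mem_insert.1 hj with rfl | hj
        · exact ⟨0, rfl⟩
        · refine ⟨Fin.succ (e.symm ⟨j, hj⟩), ?_⟩
          ext k; simp [M]
    rw [hr] at this
    exact this

theorem aux_inproj {n d : ℕ} (Δ : LMultiFan n d) (K : Finset (Fin d)) (hK : K.card + 1 = n)
    (U : (Fin n → ℝ) →ₗ[ℝ] ℝ) (hU : ∀ j ∈ K, U (Δ.toMF.v j) = 0) (i : Fin d) (hi : i ∉ K)
    (hS : insert i K ∈ Δ.S) (hUi : U (Δ.toMF.v i) ≠ 0) (z : Fin n → ℝ) (hz : U z ≠ 0) :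
    Δ.toMF.InProjCone K (insert i K) z ↔ 0 < U z * U (Δ.toMF.v i) := by
  have hsd : (insert i K) \ K = {i} := by
    ext a; simp only [mem_sdiff, mem_insert, mem_singleton]
    constructor
    · tauto
    · rintro rfl; tauto
  have hspan : ∀ y ∈ Submodule.span ℝ (Δ.toMF.v '' (K : Set (Fin d))), U y = 0 := by
    intro y hy
    have : Submodule.span ℝ (Δ.toMF.v '' (K : Set (Fin d))) ≤ LinearMap.ker U := by
      rw [Submodule.span_le]
      rintro _ ⟨j, hj, rfl⟩
      exact hU j hj
    exact this hy
  unfold MultiFan.InProjCone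
  rw [hsd]
  constructor
  · rintro ⟨a, ha, h⟩
    have h0 := hspan _ h
    have ha' := ha i (by simp)
    simp only [sum_singleton, map_sub, map_smul, smul_eq_mul] at h0
    have h1 : U z = a i * U (Δ.toMF.v i) := by linarith
    have h2 : a i ≠ 0 := by
      intro h; rw [h] at h1; simp at h1; exact hz h1
    have h3 : 0 < a i := lt_of_le_of_ne ha' h2.symm
    rw [h1]
    have := mul_self_pos.2 hUi
    nlinarith [mul_pos h3 this]
  · intro hpos
    have hc : 0 < U z / U (Δ.toMF.v i) := by
      rw [div_eq_mul_inv, ← div_eq_mul_inv]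
      have := div_pos hpos (mul_self_pos.2 hUi)
      rwa [mul_div_mul_right _ _ hUi] at this
    refine ⟨fun _ => U z / U (Δ.toMF.v i), fun _ _ => hc.le, ?_⟩
    rw [sum_singleton]
    set c := U z / U (Δ.toMF.v i)
    have hli := Δ.toMF.indep _ hS
    have htop : Submodule.span ℝ (Δ.toMF.v '' ((insert i K : Finset (Fin d)) : Set (Fin d))) = ⊤ := by
      have := hli.span_eq_top_of_card_eq_finrank' (by
        rw [Fintype.card_coe, Finset.card_insert_of_notMem hi, hK, Module.finrank_fin_fun])
      rw [← this]
      congr 1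
      ext y; simp
    have hy : z - c • Δ.toMF.v i ∈
        Submodule.span ℝ (Δ.toMF.v '' ((insert i K : Finset (Fin d)) : Set (Fin d))) := by
      rw [htop]; trivial
    rw [Finset.coe_insert, Set.image_insert_eq, Submodule.mem_span_insert] at hy
    obtain ⟨b, y, hy, he⟩ := hy
    have h1 := congrArg U he
    rw [map_add, hspan _ hy] at h1
    simp only [map_sub, map_smul, smul_eq_mul, add_zero] at h1
    have h2 : c * U (Δ.toMF.v i) = U z := div_mul_cancel₀ _ hUi
    rw [h2, sub_self] at h1
    have hb : b = 0 := by
      rcases mul_eq_zero.1 h1.symm with h | h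
      · exact h
      · exact absurd h hUi
    rw [he, hb]
    simpa using hy

open scoped Classical in
theorem aux_dv {n d : ℕ} (Δ : LMultiFan n d) (K : Finset (Fin d)) (hK : K.card + 1 = n)
    (U : (Fin n → ℝ) →ₗ[ℝ] ℝ) (hU : ∀ j ∈ K, U (Δ.toMF.v j) = 0)
    (hUi : ∀ i, i ∉ K → insert i K ∈ Δ.S → U (Δ.toMF.v i) ≠ 0) (z : Fin n → ℝ) (hz : U z ≠ 0) :
    Δ.toMF.dv K z = ∑ i ∈ univ.filter (fun i => i ∉ K ∧ insert i K ∈ Δ.S),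
      if 0 < U z * U (Δ.toMF.v i) then Δ.w (insert i K) else 0 := by
  unfold MultiFan.dv
  rw [← Finset.sum_filter]
  symm
  refine Finset.sum_bij (fun i _ => insert i K) ?_ ?_ ?_ ?_
  · intro i hi
    simp only [mem_filter, mem_univ, true_and] at hi ⊢
    obtain ⟨⟨h1, h2⟩, h3⟩ := hi
    refine ⟨h2, by rw [Finset.card_insert_of_notMem h1, hK], Finset.subset_insert _ _, ?_⟩
    exact (aux_inproj Δ K hK U hU i h1 h2 (hUi i h1 h2) z hz).2 h3
  · intro a ha b hb hab
    simp only [mem_filter, mem_univ, true_and] at ha hb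
    exact (Finset.insert_inj ha.1.1).1 hab
  · intro I hI
    simp only [mem_filter] at hI
    obtain ⟨h1, h2, h3, h4⟩ := hI
    obtain ⟨i, hi, rfl⟩ : ∃ i, i ∉ K ∧ insert i K = I := by
      have := (Finset.covBy_iff_card_sdiff_eq_one (s := I) (t := K)).2 ⟨h3, by
        rw [Finset.card_sdiff_of_subset h3]; omega⟩
      obtain ⟨a, ha, h⟩ := Finset.covBy_iff_exists_insert.1 this
      exact ⟨a, ha, h⟩
    refine ⟨i, ?_, rfl⟩
    simp only [mem_filter, mem_univ, true_and]
    exact ⟨⟨hi, h1⟩, (aux_inproj Δ K hK U hU i hi h1 (hUi i hi h1) z hz).1 h4⟩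
  · intro i _
    rfl

open scoped Classical in
theorem aux_signsum {n d : ℕ} (Δ : LMultiFan n d) (hC : Δ.toMF.Complete)
    (K : Finset (Fin d)) (hKS : K ∈ Δ.S) (hK : K.card + 1 = n)
    (u : Fin n → ℤ) (hu : ∀ j ∈ K, ∑ k, u k * Δ.v j k = 0)
    (hui : ∀ i, i ∉ K → insert i K ∈ Δ.S → ∑ k, u k * Δ.v i k ≠ 0) :
    ∑ i ∈ univ.filter (fun i => i ∉ K ∧ insert i K ∈ Δ.S),
      Int.sign (∑ k, u k * Δ.v i k) * Δ.w (insert i K) = 0 := by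
  let U : (Fin n → ℝ) →ₗ[ℝ] ℝ := Fintype.linearCombination ℝ (fun k => (u k : ℝ))
  have hUv : ∀ i, U (Δ.toMF.v i) = ((∑ k, u k * Δ.v i k : ℤ) : ℝ) := by
    intro i
    simp [U, Fintype.linearCombination_apply, LMultiFan.toMF, mul_comm]
  have hU : ∀ j ∈ K, U (Δ.toMF.v j) = 0 := fun j hj => by rw [hUv, hu j hj]; simp
  have hUi : ∀ i, i ∉ K → insert i K ∈ Δ.S → U (Δ.toMF.v i) ≠ 0 := fun i h1 h2 => by
    rw [hUv]; exact_mod_cast hui i h1 h2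
  obtain ⟨⟨I, hI, hKI, hIc⟩, hconst⟩ := hC K hKS
  obtain ⟨i, hi, rfl⟩ : ∃ i, i ∉ K ∧ insert i K = I := by
    have := (Finset.covBy_iff_card_sdiff_eq_one (s := I) (t := K)).2 ⟨hKI, by
      rw [Finset.card_sdiff_of_subset hKI]; omega⟩
    obtain ⟨a, ha, h⟩ := Finset.covBy_iff_exists_insert.1 this
    exact ⟨a, ha, h⟩
  have hgen : ∀ z, U z ≠ 0 → Δ.toMF.GenericFor K z := by
    intro z hz L _ hKL hL hmem
    have : K = L := Finset.eq_of_subset_of_card_le hKL (by omega)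
    subst this
    apply hz
    have : Submodule.span ℝ (Δ.toMF.v '' (K : Set (Fin d))) ≤ LinearMap.ker U := by
      rw [Submodule.span_le]
      rintro _ ⟨j, hj, rfl⟩
      exact hU j hj
    exact this hmem
  obtain ⟨z, hz⟩ : ∃ z, 0 < U z := by
    rcases lt_or_gt_of_ne (hUi i hi hI) with h | h
    · exact ⟨-Δ.toMF.v i, by rw [map_neg]; linarith⟩
    · exact ⟨_, h⟩
  have hz' : U (-z) < 0 := by rw [map_neg]; linarith
  have h := hconst z (-z) (hgen _ hz.ne') (hgen _ hz'.ne)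
  rw [aux_dv Δ K hK U hU hUi z hz.ne', aux_dv Δ K hK U hU hUi (-z) hz'.ne, ← sub_eq_zero,
    ← Finset.sum_sub_distrib] at h
  rw [← h]
  refine Finset.sum_congr rfl fun j hj => ?_
  have h4 : 0 < U z * U (Δ.toMF.v j) ↔ 0 < (∑ k, u k * Δ.v j k) := by
    rw [mul_pos_iff_of_pos_left hz, hUv]
    exact Int.cast_pos
  have h3 : 0 < U (-z) * U (Δ.toMF.v j) ↔ (∑ k, u k * Δ.v j k) < 0 := by
    rw [hUv, map_neg, neg_mul, ← mul_neg, mul_pos_iff_of_pos_left hz, neg_pos]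
    exact Int.cast_lt_zero
  rw [if_congr h3 rfl rfl, if_congr h4 rfl rfl]
  simp only [mem_filter] at hj
  rcases lt_or_gt_of_ne (hui j hj.2.1 hj.2.2) with h | h
  · rw [Int.sign_eq_neg_one_of_neg h, if_neg (by omega), if_pos h]; ring
  · rw [Int.sign_eq_one_of_pos h, if_pos h, if_neg h.le.not_gt]; ring

/-- The linear form attached to a covector. -/
noncomputable def auxLin {n : ℕ} (u : Fin n → ℚ) : MvPolynomial (Fin n) ℚ :=
  ∑ k : Fin n, u k • MvPolynomial.X k

theorem auxLin_coeff {n : ℕ} (u : Fin n → ℚ) (k : Fin n) :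
    (auxLin u).coeff (Finsupp.single k 1) = u k := by
  classical
  simp [auxLin, MvPolynomial.coeff_sum, MvPolynomial.coeff_X, Finsupp.single_left_inj]

theorem auxLin_ne {n : ℕ} (u y : Fin n → ℚ) (h : ∑ k, u k * y k ≠ 0) : auxLin u ≠ 0 := by
  intro h0
  apply h
  refine Finset.sum_eq_zero fun k _ => ?_
  rw [← auxLin_coeff u k, h0]
  simp

/-- `π^*(u)` in the polynomial ring on the rays. -/
noncomputable def auxLift {n d : ℕ} (Δ : LMultiFan n d) (u : Fin n → ℚ) :
    MvPolynomial (Fin d) ℚ :=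
  ∑ i : Fin d, MvPolynomial.C (∑ k, u k * (Δ.v i k : ℚ)) * MvPolynomial.X i

theorem aux_expand {n d : ℕ} (Δ : LMultiFan n d)
    (uu : Finset (Fin d) → Fin d → (Fin n → ℚ)) (huu : DualBasisQ Δ uu)
    (I : Finset (Fin d)) (hI : I ∈ Δ.S) (hc : I.card = n) (u : Fin n → ℚ) (k : Fin n) :
    ∑ i ∈ I, (∑ l, u l * (Δ.v i l : ℚ)) * uu I i k = u k := by
  classical
  let A : Matrix {x // x ∈ I} (Fin n) ℚ := Matrix.of fun i k => uu I i k
  let B : Matrix (Fin n) {x // x ∈ I} ℚ := Matrix.of fun k i => (Δ.v i k : ℚ)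
  have hAB : A * B = 1 := by
    ext i j
    rw [Matrix.mul_apply, Matrix.one_apply]
    have := huu I hI hc i i.2 j j.2
    rw [if_congr (Subtype.ext_iff (a1 := i) (a2 := j)) rfl rfl]
    exact this
  have hBA : B * A = 1 := (Matrix.mul_eq_one_comm_of_card_eq _ _ _
    (by rw [Fintype.card_coe, hc, Fintype.card_fin])).1 hAB
  have h : Matrix.vecMul u (B * A) k = u k := by rw [hBA, Matrix.vecMul_one]
  rw [← Matrix.vecMul_vecMul] at h
  rw [← Finset.sum_coe_sort I]
  exact h

theorem aux_iota_lift {n d : ℕ} (Δ : LMultiFan n d)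
    (uu : Finset (Fin d) → Fin d → (Fin n → ℚ)) (huu : DualBasisQ Δ uu)
    (I : Finset (Fin d)) (hI : I ∈ Δ.S) (hc : I.card = n) (u : Fin n → ℚ) :
    iotaStar uu I (auxLift Δ u) = auxLin u := by
  classical
  have h1 : iotaStar uu I (auxLift Δ u)
      = ∑ i ∈ I, (∑ l, u l * (Δ.v i l : ℚ)) • auxLin (uu I i) := by
    simp only [auxLift, iotaStar, map_sum, map_mul, MvPolynomial.aeval_X, mul_ite, mul_zero,
      MvPolynomial.aeval_C, Finset.sum_ite_mem, Finset.univ_inter]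
    refine Finset.sum_congr rfl fun i _ => ?_
    rw [Algebra.smul_def, map_sum]
    simp only [map_mul]
    rfl
  rw [h1]
  simp only [auxLin, Finset.smul_sum, smul_smul]
  rw [Finset.sum_comm]
  refine Finset.sum_congr rfl fun k _ => ?_
  rw [← Finset.sum_smul, aux_expand Δ uu huu I hI hc]

section
variable {n d : ℕ} (Δ : LMultiFan n d) (uu : Finset (Fin d) → Fin d → (Fin n → ℚ))

theorem aux_add (x y : MvPolynomial (Fin d) ℚ) :
    piShriek Δ uu (x + y) = piShriek Δ uu x + piShriek Δ uu y := by
  unfold piShriek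
  rw [← Finset.sum_add_distrib]
  refine Finset.sum_congr rfl fun I _ => ?_
  rw [map_add, map_add]; ring

theorem aux_mul (y : MvPolynomial (Fin d) ℚ) (q : MvPolynomial (Fin n) ℚ)
    (h : ∀ I ∈ Δ.S, I.card = n → iotaStar uu I y = q) (x : MvPolynomial (Fin d) ℚ) :
    piShriek Δ uu (y * x) = algebraMap _ _ q * piShriek Δ uu x := by
  unfold piShriek
  rw [Finset.mul_sum]
  refine Finset.sum_congr rfl fun I hI => ?_
  rw [Finset.mem_filter] at hI
  rw [map_mul, h I hI.1 hI.2, map_mul]; ring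

theorem aux_C_mul (a : ℚ) (x : MvPolynomial (Fin d) ℚ) :
    piShriek Δ uu (MvPolynomial.C a * x)
      = algebraMap _ _ (MvPolynomial.C a : MvPolynomial (Fin n) ℚ) * piShriek Δ uu x :=
  aux_mul Δ uu _ _ (fun I _ _ => by simp [iotaStar, MvPolynomial.algebraMap_eq]) x

theorem aux_sum (T : Finset (Fin d)) (f : Fin d → MvPolynomial (Fin d) ℚ) :
    piShriek Δ uu (∑ i ∈ T, f i) = ∑ i ∈ T, piShriek Δ uu (f i) :=
  map_sum (AddMonoidHom.mk' (piShriek Δ uu) (aux_add Δ uu)) f T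

theorem aux_iota_zero (I J : Finset (Fin d)) (h : ¬ J ⊆ I) :
    iotaStar uu I (∏ i ∈ J, MvPolynomial.X i) = 0 := by
  obtain ⟨j, hj, hjI⟩ := Finset.not_subset.1 h
  rw [map_prod]
  refine Finset.prod_eq_zero hj ?_
  simp [iotaStar, hjI]

theorem aux_notMem (J : Finset (Fin d)) (hJ : J ∉ Δ.S) (p : MvPolynomial (Fin d) ℚ) :
    piShriek Δ uu (p * ∏ i ∈ J, MvPolynomial.X i) = 0 := by
  unfold piShriek
  refine Finset.sum_eq_zero fun I hI => ?_
  rw [Finset.mem_filter] at hI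
  rw [map_mul, aux_iota_zero uu I J (fun h => hJ (Δ.downClosed I hI.1 J h))]
  simp

theorem aux_top (huu : DualBasisQ Δ uu) (J : Finset (Fin d)) (hJ : J ∈ Δ.S) (hc : J.card = n) :
    piShriek Δ uu (∏ i ∈ J, MvPolynomial.X i)
        = algebraMap (MvPolynomial (Fin n) ℚ) (FractionRing (MvPolynomial (Fin n) ℚ))
            (MvPolynomial.C ((Δ.w J : ℚ) /
              (Nat.card ((Fin n → ℤ) ⧸ Submodule.span ℤ (Δ.v '' (J : Set (Fin d)))) : ℚ))) := by
  unfold piShriek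
  rw [Finset.sum_eq_single J]
  · have h1 : iotaStar uu J (∏ i ∈ J, MvPolynomial.X i)
        = ∏ i ∈ J, ∑ k : Fin n, uu J i k • MvPolynomial.X k := by
      rw [map_prod]
      refine Finset.prod_congr rfl fun i hi => ?_
      simp [iotaStar, hi]
    rw [h1, div_self, mul_one]
    rw [Ne, FaithfulSMul.algebraMap_eq_zero_iff, Finset.prod_eq_zero_iff]
    rintro ⟨i, hi, h0⟩
    refine auxLin_ne (uu J i) (fun k => (Δ.v i k : ℚ)) ?_ h0
    rw [huu J hJ hc i hi i hi]
    simp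
  · intro I hI hne
    rw [Finset.mem_filter] at hI
    rw [aux_iota_zero uu I J (fun h => hne (Finset.eq_of_subset_of_card_le h (by omega)).symm)]
    simp
  · intro h
    exact absurd (Finset.mem_filter.2 ⟨hJ, hc⟩) h

/-- The basic relation: for a covector `u` vanishing on `J` outside of `T`. -/
theorem aux_rel (huu : DualBasisQ Δ uu) (u : Fin n → ℚ) (p : MvPolynomial (Fin d) ℚ)
    (J : Finset (Fin d)) :
    algebraMap _ _ (auxLin u) * piShriek Δ uu (p * ∏ i ∈ J, MvPolynomial.X i) =
      ∑ i ∈ J, algebraMap _ _ (MvPolynomial.C (∑ k, u k * (Δ.v i k : ℚ)) : MvPolynomial (Fin n) ℚ) *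
        piShriek Δ uu (p * MvPolynomial.X i * ∏ i ∈ J, MvPolynomial.X i) +
      ∑ i ∈ Jᶜ, algebraMap _ _ (MvPolynomial.C (∑ k, u k * (Δ.v i k : ℚ)) :
          MvPolynomial (Fin n) ℚ) *
        piShriek Δ uu (p * ∏ i ∈ insert i J, MvPolynomial.X i) := by
  rw [← aux_mul Δ uu (auxLift Δ u) (auxLin u)
    (fun I hI hc => aux_iota_lift Δ uu huu I hI hc u), auxLift, Finset.sum_mul, aux_sum,
    ← Finset.sum_add_sum_compl J]
  congr 1
  · refine Finset.sum_congr rfl fun i _ => ?_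
    rw [← aux_C_mul]
    congr 1; ring
  · refine Finset.sum_congr rfl fun i hi => ?_
    rw [← aux_C_mul, Finset.prod_insert (Finset.mem_compl.1 hi)]
    congr 1; ring

theorem aux_vanish (hC : Δ.toMF.Complete) (huu : DualBasisQ Δ uu) :
    ∀ m : ℕ, ∀ J ∈ Δ.S, J.card + (m + 1) = n →
      piShriek Δ uu (∏ i ∈ J, MvPolynomial.X i) = 0 := by
  classical
  intro m
  induction m with
  | zero =>
    intro J hJ hc
    obtain ⟨u, hu, hu'⟩ := aux_covector Δ J hc
    obtain ⟨⟨I, hI, hJI, hIc⟩, -⟩ := hC J hJ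
    have hss := aux_signsum Δ hC J hJ hc u hu (fun i h1 h2 => (hu' i h1 h2).2)
    have hcast : ∀ i, ∑ k, ((u k : ℚ)) * (Δ.v i k : ℚ) = ((∑ k, u k * Δ.v i k : ℤ) : ℚ) := by
      intro i; push_cast; rfl
    have hne : auxLin (fun k => (u k : ℚ)) ≠ 0 := by
      obtain ⟨i, hi, hiJ⟩ : ∃ i ∈ I, i ∉ J :=
        Finset.exists_mem_notMem_of_card_lt_card (by omega)
      refine auxLin_ne _ (fun k => (Δ.v i k : ℚ)) ?_
      rw [hcast]
      exact_mod_cast (hu' i hiJ (Δ.downClosed I hI _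
        (Finset.insert_subset hi hJI))).2
    have hrel := aux_rel Δ uu huu (fun k => (u k : ℚ)) 1 J
    simp only [one_mul, hcast] at hrel
    rw [Finset.sum_eq_zero (s := J) (fun i hi => by rw [hu i hi]; simp), zero_add] at hrel
    have h2 : ∑ i ∈ Jᶜ, algebraMap (MvPolynomial (Fin n) ℚ)
          (FractionRing (MvPolynomial (Fin n) ℚ))
          (MvPolynomial.C ((∑ k, u k * Δ.v i k : ℤ) : ℚ)) *
        piShriek Δ uu (∏ i ∈ insert i J, MvPolynomial.X i) =
        ∑ i ∈ Jᶜ, algebraMap (MvPolynomial (Fin n) ℚ)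
          (FractionRing (MvPolynomial (Fin n) ℚ)) (MvPolynomial.C
          ((if insert i J ∈ Δ.S then
            Int.sign (∑ k, u k * Δ.v i k) * Δ.w (insert i J) else 0 : ℤ) : ℚ)) := by
      refine Finset.sum_congr rfl fun i hi => ?_
      rw [Finset.mem_compl] at hi
      split_ifs with hS
      · obtain ⟨hcard, hnz⟩ := hu' i hi hS
        rw [aux_top Δ uu huu _ hS (by rw [Finset.card_insert_of_notMem hi]; omega), hcard,
          ← map_mul, ← map_mul]
        congr 2
        generalize (∑ k, u k * Δ.v i k) = a at hnz
        have ha : ((a.natAbs : ℤ) : ℚ) ≠ 0 := by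
          exact_mod_cast Int.natAbs_ne_zero.2 hnz
        have h5 : (a : ℚ) = (a.sign : ℚ) * ((a.natAbs : ℤ) : ℚ) := by
          exact_mod_cast (Int.sign_mul_natAbs a).symm
        have h6 : ((a.natAbs : ℕ) : ℚ) = ((a.natAbs : ℤ) : ℚ) := by simp
        rw [h6]
        conv_lhs => rw [h5]
        push_cast at ha ⊢
        field_simp
      · have := aux_notMem Δ uu _ hS 1
        rw [one_mul] at this
        rw [this]; simp
    rw [h2, ← map_sum, ← map_sum, ← Int.cast_sum, ← Finset.sum_filter] at hrel
    have hset : Jᶜ.filter (fun i => insert i J ∈ Δ.S)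
        = univ.filter (fun i => i ∉ J ∧ insert i J ∈ Δ.S) := by
      ext i; simp
    rw [hset, hss] at hrel
    simp only [Int.cast_zero, map_zero, mul_eq_zero, FaithfulSMul.algebraMap_eq_zero_iff] at hrel
    exact hrel.resolve_left hne
  | succ m ih =>
    intro J hJ hc
    obtain ⟨⟨I, hI, hJI, hIc⟩, -⟩ := hC J hJ
    obtain ⟨i, hi, hiJ⟩ : ∃ i ∈ I, i ∉ J :=
      Finset.exists_mem_notMem_of_card_lt_card (by omega)
    have hne : auxLin (uu I i) ≠ 0 := by
      refine auxLin_ne _ (fun k => (Δ.v i k : ℚ)) ?_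
      rw [huu I hI hIc i hi i hi]; simp
    have hrel := aux_rel Δ uu huu (uu I i) 1 J
    simp only [one_mul] at hrel
    rw [Finset.sum_eq_zero (s := J) (fun j hj => by
      rw [huu I hI hIc i hi j (hJI hj), if_neg (by rintro rfl; exact hiJ hj)]; simp),
      zero_add, Finset.sum_eq_zero] at hrel
    · simp only [mul_eq_zero, FaithfulSMul.algebraMap_eq_zero_iff] at hrel
      exact hrel.resolve_left hne
    · intro j hj
      rw [Finset.mem_compl] at hj
      by_cases hS : insert j J ∈ Δ.S
      · rw [ih _ hS (by rw [Finset.card_insert_of_notMem hj]; omega), mul_zero]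
      · have := aux_notMem Δ uu _ hS 1
        rw [one_mul] at this
        rw [this, mul_zero]

theorem aux_range (hC : Δ.toMF.Complete) (huu : DualBasisQ Δ uu) :
    ∀ m : ℕ, ∀ J : Finset (Fin d), J.card + m = d → ∀ p : MvPolynomial (Fin d) ℚ,
      piShriek Δ uu (p * ∏ i ∈ J, MvPolynomial.X i) ∈
        (algebraMap (MvPolynomial (Fin n) ℚ) (FractionRing (MvPolynomial (Fin n) ℚ))).range := by
  classical
  intro m
  induction m using Nat.strong_induction_on with
  | _ m ih =>
  intro J hJd p
  by_cases hJ : J ∉ Δ.S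
  · rw [aux_notMem Δ uu J hJ]; exact zero_mem _
  rw [not_not] at hJ
  have hins : ∀ i, i ∉ J → ∀ p, piShriek Δ uu (p * ∏ i ∈ insert i J, MvPolynomial.X i) ∈
      (algebraMap (MvPolynomial (Fin n) ℚ) (FractionRing (MvPolynomial (Fin n) ℚ))).range := by
    intro i hi p
    have h1 : (insert i J).card ≤ d := by simpa using Finset.card_le_univ (insert i J)
    have h2 := Finset.card_insert_of_notMem hi
    exact ih (m - 1) (by omega) _ (by omega) p
  induction p using MvPolynomial.induction_on with
  | C a =>
    rw [aux_C_mul]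
    refine mul_mem ⟨_, rfl⟩ ?_
    rcases (Δ.card_le J hJ).eq_or_lt with h | h
    · rw [aux_top Δ uu huu J hJ h]; exact ⟨_, rfl⟩
    · rw [aux_vanish Δ uu hC huu (n - J.card - 1) J hJ (by omega)]; exact zero_mem _
  | add p q hp hq =>
    rw [add_mul, aux_add]; exact add_mem hp hq
  | mul_X p i hp =>
    by_cases hi : i ∈ J
    · obtain ⟨⟨I, hI, hJI, hIc⟩, -⟩ := hC J hJ
      have hrel := aux_rel Δ uu huu (uu I i) p J
      rw [Finset.sum_eq_single i] at hrel
      · rw [huu I hI hIc i (hJI hi) i (hJI hi), if_pos rfl, MvPolynomial.C_1, map_one,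
          one_mul] at hrel
        replace hrel := eq_sub_of_add_eq hrel.symm
        rw [hrel]
        refine sub_mem (mul_mem ⟨_, rfl⟩ hp) (sum_mem fun j hj => mul_mem ⟨_, rfl⟩ ?_)
        exact hins j (Finset.mem_compl.1 hj) p
      · intro j hj hji
        rw [huu I hI hIc i (hJI hi) j (hJI hj), if_neg (Ne.symm hji)]; simp
      · exact fun h => absurd hi h
    · rw [mul_assoc, ← Finset.prod_insert hi]
      exact hins i hi p

end

/-- **Lemma 8.4**: the image of the index map `π_!` lies in the polynomial ring
`H^*(BT;ℚ)`; in particular `π_!(x_J) = w(J)/|N/N_J|` for `J ∈ Σ^{(n)}` and `π_!(x_J) = 0`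
for `J ∈ Σ` with `|J| < n`. -/
theorem stmt16 (n d : ℕ) (Δ : LMultiFan n d) (hC : Δ.toMF.Complete)
    (uu : Finset (Fin d) → Fin d → (Fin n → ℚ)) (huu : DualBasisQ Δ uu) :
    (∀ x : MvPolynomial (Fin d) ℚ, ∃ p : MvPolynomial (Fin n) ℚ,
      piShriek Δ uu x
        = algebraMap (MvPolynomial (Fin n) ℚ) (FractionRing (MvPolynomial (Fin n) ℚ)) p) ∧
    (∀ J ∈ Δ.S, J.card = n →
      piShriek Δ uu (∏ i ∈ J, MvPolynomial.X i)
        = algebraMap (MvPolynomial (Fin n) ℚ) (FractionRing (MvPolynomial (Fin n) ℚ))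
            (MvPolynomial.C ((Δ.w J : ℚ) /
              (Nat.card ((Fin n → ℤ) ⧸ Submodule.span ℤ (Δ.v '' (J : Set (Fin d)))) : ℚ)))) ∧
    (∀ J ∈ Δ.S, J.card < n →
      piShriek Δ uu (∏ i ∈ J, MvPolynomial.X i) = 0) := by
  refine ⟨fun x => ?_, fun J hJ hc => aux_top Δ uu huu J hJ hc, fun J hJ hc =>
    aux_vanish Δ uu hC huu (n - J.card - 1) J hJ (by omega)⟩
  obtain ⟨p, hp⟩ := aux_range Δ uu hC huu d ∅ (by simp) x
  refine ⟨p, ?_⟩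
  rw [hp, Finset.prod_empty, mul_one]
end
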